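/- Let p be a prime, let f = (f_1,…,f_t) be a nonconstant polynomial mapping with f_1,…,f_t ∈ ℤ_p[x_1,…,x_n], f_i(0) = 0 for all i, and suppose n ≥ t+1. Let g ∈ ℤ_p[x_1,…,x_n] be a nonconstant polynomial with g(0) = 0 that is non-degenerated over F_p with respect to its Newton polyhedron. Suppose f is strongly non-degenerated over F_p with respect to Γ(f) and (f,g) is strongly non-degenerated over F_p with respect to the partition D_{f,g}. Then for every complex s with Re(s) > 0, Z_{f,g}(s) = ∫_{ℤ_p^n} ‖f(x)‖^s |g(x)| dμ = Σ_{δ ∈ D_{f,g}} L_δ(s) S_δ(s), where for each δ ∈ D_{f,g}: L_δ(s) = p^{-n}((p−1)^n − p^t·N_δ·(p^s−1)/(p^{s+t}−1) − P_δ·p/(p+1) − p·Q_δ·(p^{t−1}(p^s(p+1)−1)−1)/((p^{s+t}−1)(p+1))) with N_δ = #{a ∈ (F_p^×)^n : f̄_δ(a)=0, ḡ_δ(a)≠0}, P_δ = #{a ∈ (F_p^×)^n : f̄_δ(a)≠0, ḡ_δ(a)=0}, Q_δ = #{a ∈ (F_p^×)^n : f̄_δ(a)=0, ḡ_δ(a)=0};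 and S_δ(s) = Σ_{k ∈ ℕ^n ∩ δ} p^{−m_f(k)s − m_g(k) − σ(k)}, this series converging absolutely. -/

import Mathlib

open MeasureTheory MvPolynomial

/-! Igusa's local zeta function of a polynomial mapping `F = (f_1,…,f_t)` and a
polynomial measure `|g(x)||dx|` (Theorem `theo_form3`). -/

noncomputable instance (p : ℕ) [Fact p.Prime] : MeasurableSpace ℤ_[p] := borel _
instance (p : ℕ) [Fact p.Prime] : BorelSpace ℤ_[p] := ⟨rfl⟩

/-- The Haar measure on `ℤ_p^n`, normalized so that `μ(ℤ_p^n) = 1`. -/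
noncomputable def padicHaar (p : ℕ) [Fact p.Prime] (n : ℕ) : Measure (Fin n → ℤ_[p]) :=
  Measure.addHaarMeasure ⟨⟨Set.univ, isCompact_univ⟩, by simp⟩

/-- The nonnegative orthant `ℝ_{≥0}^n`. -/
def orthant (n : ℕ) : Set (Fin n → ℝ) := {x | ∀ i, 0 ≤ x i}

/-- Embedding of exponent vectors into `ℝ^n`. -/
def toR {n : ℕ} (ω : Fin n →₀ ℕ) : Fin n → ℝ := fun i => (ω i : ℝ)

/-- Embedding of `ℕ^n` into `ℝ^n`. -/
def toRn {n : ℕ} (k : Fin n → ℕ) : Fin n → ℝ := fun i => (k i : ℝ)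

/-- `σ(k) = k_1 + ⋯ + k_n`. -/
def sigmaFn {n : ℕ} (k : Fin n → ℕ) : ℝ := ∑ i, (k i : ℝ)

/-- The Newton polyhedron `Γ(g)` of a single polynomial. -/
noncomputable def newtonPoly {p n : ℕ} [Fact p.Prime] (g : MvPolynomial (Fin n) ℤ_[p]) :
    Set (Fin n → ℝ) :=
  convexHull ℝ (⋃ ω ∈ g.support, (fun c => toR ω + c) '' orthant n)

/-- The Newton polyhedron `Γ(F)` of a polynomial mapping `F = (f_1,…,f_t)`: the convex
hull of `⋃_{ω ∈ supp F} (ω + ℝ_{≥0}^n)` where `supp F = ⋃_i supp f_i`. -/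
noncomputable def newtonPolyMap {p n t : ℕ} [Fact p.Prime]
    (F : Fin t → MvPolynomial (Fin n) ℤ_[p]) : Set (Fin n → ℝ) :=
  convexHull ℝ (⋃ i, ⋃ ω ∈ (F i).support, (fun c => toR ω + c) '' orthant n)

/-- `m_Γ(k) = inf_{x ∈ Γ} k·x`. -/
noncomputable def mP {n : ℕ} (Γ : Set (Fin n → ℝ)) (k : Fin n → ℝ) : ℝ :=
  sInf ((fun x => ∑ i, k i * x i) '' Γ)

/-- The first meet locus `F_Γ(k) = {x ∈ Γ | k·x = m_Γ(k)}`. -/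
noncomputable def faceOf {n : ℕ} (Γ : Set (Fin n → ℝ)) (k : Fin n → ℝ) : Set (Fin n → ℝ) :=
  {x ∈ Γ | ∑ i, k i * x i = mP Γ k}

open Classical in
/-- `g_τ'` for `τ' = F_{Γ(g)}(k)`. -/
noncomputable def facePoly {p n : ℕ} [Fact p.Prime] (g : MvPolynomial (Fin n) ℤ_[p])
    (k : Fin n → ℝ) : MvPolynomial (Fin n) ℤ_[p] :=
  (g.support.filter (fun ω => toR ω ∈ faceOf (newtonPoly g) k)).sum
    (fun ω => monomial ω (g.coeff ω))

open Classical in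
/-- `f_{i,τ}` for `τ = F_{Γ(F)}(k)`: the sum of the terms of `f_i` supported on the
face of `Γ(F)` which is the first meet locus of `k`. -/
noncomputable def facePolyMap {p n t : ℕ} [Fact p.Prime]
    (F : Fin t → MvPolynomial (Fin n) ℤ_[p]) (i : Fin t) (k : Fin n → ℝ) :
    MvPolynomial (Fin n) ℤ_[p] :=
  ((F i).support.filter (fun ω => toR ω ∈ faceOf (newtonPolyMap F) k)).sum
    (fun ω => monomial ω ((F i).coeff ω))

/-- Reduction of a polynomial over `ℤ_p` modulo `p`. -/
noncomputable def redp {p n : ℕ} [Fact p.Prime] (g : MvPolynomial (Fin n) ℤ_[p]) :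
    MvPolynomial (Fin n) (ZMod p) :=
  g.map (PadicInt.toZMod)

/-- `g` is non-degenerated over `𝔽_p` with respect to all the faces of its Newton
polyhedron. -/
def NonDeg (p : ℕ) [Fact p.Prime] {n : ℕ} (g : MvPolynomial (Fin n) ℤ_[p]) : Prop :=
  ∀ k ∈ orthant n, ¬ ∃ a : Fin n → ℤ_[p], (∀ i, IsUnit (a i)) ∧
    (p : ℤ_[p]) ∣ eval a (facePoly g k) ∧
    ∀ i, (p : ℤ_[p]) ∣ eval a (pderiv i (facePoly g k))

/-- `F` is strongly non-degenerated over `𝔽_p` with respect to its Newton polyhedron: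
for every face `τ = F_F(k)` of `Γ(F)` and every `a ∈ (ℤ_p^×)^n` with `F_τ(a) ≡ 0 mod p`,
the `t×n` Jacobian matrix `(∂f_{i,τ}/∂x_j(a))` has rank `min t n` modulo `p`. -/
def StronglyNonDegMap (p : ℕ) [Fact p.Prime] {n t : ℕ}
    (F : Fin t → MvPolynomial (Fin n) ℤ_[p]) : Prop :=
  ∀ k ∈ orthant n, ∀ a : Fin n → ℤ_[p], (∀ i, IsUnit (a i)) →
    (∀ i, (p : ℤ_[p]) ∣ eval a (facePolyMap F i k)) →
    Matrix.rank (Matrix.of fun (i : Fin t) (j : Fin n) =>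
      PadicInt.toZMod (eval a (pderiv j (facePolyMap F i k)))) = min t n

/-- The partition `D_{F,g}` of `ℝ_{≥0}^n`: the equivalence classes of
`k ∼ k' ↔ F_F(k) = F_F(k') ∧ F_g(k) = F_g(k')`. -/
noncomputable def DFg {p n t : ℕ} [Fact p.Prime] (F : Fin t → MvPolynomial (Fin n) ℤ_[p])
    (g : MvPolynomial (Fin n) ℤ_[p]) : Set (Set (Fin n → ℝ)) :=
  {δ | ∃ k ∈ orthant n, δ = {k' ∈ orthant n |
    faceOf (newtonPolyMap F) k' = faceOf (newtonPolyMap F) k ∧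
    faceOf (newtonPoly g) k' = faceOf (newtonPoly g) k}}

open Classical in
/-- For a cone `δ ∈ D_{F,g}`, the polynomial `g_δ` (computed from any point of `δ`). -/
noncomputable def conePoly {p n : ℕ} [Fact p.Prime] (g : MvPolynomial (Fin n) ℤ_[p])
    (δ : Set (Fin n → ℝ)) : MvPolynomial (Fin n) ℤ_[p] :=
  if h : δ.Nonempty then facePoly g h.some else 0

open Classical in
/-- For a cone `δ ∈ D_{F,g}`, the polynomial `f_{i,δ}` (computed from any point of `δ`). -/
noncomputable def conePolyMap {p n t : ℕ} [Fact p.Prime]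
    (F : Fin t → MvPolynomial (Fin n) ℤ_[p]) (i : Fin t) (δ : Set (Fin n → ℝ)) :
    MvPolynomial (Fin n) ℤ_[p] :=
  if h : δ.Nonempty then facePolyMap F i h.some else 0

/-- The pair `(F,g)` is strongly non-degenerated over `𝔽_p` with respect to `D_{F,g}`:
for every cone `δ` and every `ā ∈ (𝔽_p^×)^n` with
`f̄_{1,δ}(ā) = ⋯ = f̄_{t,δ}(ā) = ḡ_δ(ā) = 0`, the `(t+1)×n` Jacobian matrix of
`(f̄_{1,δ},…,f̄_{t,δ},ḡ_δ)` at `ā` has rank `t+1`. -/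
def StronglyNonDegPair (p : ℕ) [Fact p.Prime] {n t : ℕ}
    (F : Fin t → MvPolynomial (Fin n) ℤ_[p]) (g : MvPolynomial (Fin n) ℤ_[p]) : Prop :=
  ∀ δ ∈ DFg F g, ∀ a : Fin n → ZMod p, (∀ i, a i ≠ 0) →
    (∀ i, eval a (redp (conePolyMap F i δ)) = 0) → eval a (redp (conePoly g δ)) = 0 →
    Matrix.rank (Matrix.of fun (i : Fin (t + 1)) (j : Fin n) =>
      Fin.lastCases (motive := fun _ => ZMod p) (eval a (pderiv j (redp (conePoly g δ))))
        (fun i' => eval a (pderiv j (redp (conePolyMap F i' δ)))) i) = t + 1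

/-- `N_δ = #{a ∈ (𝔽_p^×)^n : F̄_δ(a) = 0 and ḡ_δ(a) ≠ 0}`. -/
noncomputable def Ndelta (p : ℕ) [Fact p.Prime] {n t : ℕ}
    (F : Fin t → MvPolynomial (Fin n) ℤ_[p]) (g : MvPolynomial (Fin n) ℤ_[p])
    (δ : Set (Fin n → ℝ)) : ℕ :=
  Set.ncard {a : Fin n → ZMod p | (∀ i, a i ≠ 0) ∧
    (∀ i, eval a (redp (conePolyMap F i δ)) = 0) ∧ eval a (redp (conePoly g δ)) ≠ 0}

/-- `P_δ = #{a ∈ (𝔽_p^×)^n : F̄_δ(a) ≠ 0 and ḡ_δ(a) = 0}`. -/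
noncomputable def Pdelta (p : ℕ) [Fact p.Prime] {n t : ℕ}
    (F : Fin t → MvPolynomial (Fin n) ℤ_[p]) (g : MvPolynomial (Fin n) ℤ_[p])
    (δ : Set (Fin n → ℝ)) : ℕ :=
  Set.ncard {a : Fin n → ZMod p | (∀ i, a i ≠ 0) ∧
    (¬ ∀ i, eval a (redp (conePolyMap F i δ)) = 0) ∧ eval a (redp (conePoly g δ)) = 0}

/-- `Q_δ = #{a ∈ (𝔽_p^×)^n : F̄_δ(a) = 0 and ḡ_δ(a) = 0}`. -/
noncomputable def Qdelta (p : ℕ) [Fact p.Prime] {n t : ℕ}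
    (F : Fin t → MvPolynomial (Fin n) ℤ_[p]) (g : MvPolynomial (Fin n) ℤ_[p])
    (δ : Set (Fin n → ℝ)) : ℕ :=
  Set.ncard {a : Fin n → ZMod p | (∀ i, a i ≠ 0) ∧
    (∀ i, eval a (redp (conePolyMap F i δ)) = 0) ∧ eval a (redp (conePoly g δ)) = 0}

/-- The factor `L_δ(s)`. -/
noncomputable def Ldelta (p : ℕ) [Fact p.Prime] {n t : ℕ}
    (F : Fin t → MvPolynomial (Fin n) ℤ_[p]) (g : MvPolynomial (Fin n) ℤ_[p])
    (δ : Set (Fin n → ℝ)) (s : ℂ) : ℂ :=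
  (p : ℂ) ^ (-(n : ℤ)) * (((p : ℂ) - 1) ^ n
    - (p : ℂ) ^ (t : ℕ) * (Ndelta p F g δ) * ((p : ℂ) ^ s - 1) / ((p : ℂ) ^ (s + t) - 1)
    - (Pdelta p F g δ) * (p : ℂ) / ((p : ℂ) + 1)
    - (p : ℂ) * (Qdelta p F g δ) *
        ((p : ℂ) ^ ((t : ℕ) - 1) * ((p : ℂ) ^ s * ((p : ℂ) + 1) - 1) - 1)
        / (((p : ℂ) ^ (s + t) - 1) * ((p : ℂ) + 1)))

/-- The summand of the series `S_δ(s)` at a lattice point `k ∈ ℕ^n ∩ δ`. -/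
noncomputable def Sterm (p : ℕ) [Fact p.Prime] {n t : ℕ}
    (F : Fin t → MvPolynomial (Fin n) ℤ_[p]) (g : MvPolynomial (Fin n) ℤ_[p])
    (s : ℂ) (k : Fin n → ℕ) : ℂ :=
  (p : ℂ) ^ (-(mP (newtonPolyMap F) (toRn k) : ℂ) * s
    - (mP (newtonPoly g) (toRn k) : ℂ) - (sigmaFn k : ℂ))

/-- The series `S_δ(s) = Σ_{k ∈ ℕ^n ∩ δ} p^{-m_F(k)s - m_g(k) - σ(k)}`. -/
noncomputable def Sdelta (p : ℕ) [Fact p.Prime] {n t : ℕ}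
    (F : Fin t → MvPolynomial (Fin n) ℤ_[p]) (g : MvPolynomial (Fin n) ℤ_[p])
    (δ : Set (Fin n → ℝ)) (s : ℂ) : ℂ :=
  ∑' k : {k : Fin n → ℕ // toRn k ∈ δ}, Sterm p F g s k

/-- `‖F(x)‖ = max_{1≤i≤t} |f_i(x)|`. -/
noncomputable def mapNorm {p n t : ℕ} [Fact p.Prime]
    (F : Fin t → MvPolynomial (Fin n) ℤ_[p]) (x : Fin n → ℤ_[p]) : ℝ :=
  ⨆ i, ‖eval x (F i)‖


section measure
variable {p : ℕ} [Fact p.Prime] {n : ℕ}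

instance padicHaar_isAddHaar : (padicHaar p n).IsAddHaarMeasure := by
  unfold padicHaar; infer_instance

instance padicHaar_prob : IsProbabilityMeasure (padicHaar p n) := by
  constructor
  unfold padicHaar
  exact Measure.addHaarMeasure_self (K₀ := ⟨⟨Set.univ, isCompact_univ⟩, by simp⟩)

/-- coordinatewise scaling by `p^k` -/
noncomputable def scal (k : Fin n → ℕ) : (Fin n → ℤ_[p]) →+ (Fin n → ℤ_[p]) where
  toFun z := fun i => (p : ℤ_[p]) ^ k i * z i
  map_zero' := by ext i; simp
  map_add' x y := by ext i; simp [mul_add]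

lemma scal_apply (k : Fin n → ℕ) (z : Fin n → ℤ_[p]) (i : Fin n) :
    scal k z i = (p : ℤ_[p]) ^ k i * z i := rfl

lemma pne : (p : ℤ_[p]) ≠ 0 := by
  have := (Fact.out : p.Prime).ne_zero
  exact_mod_cast this

lemma scal_inj (k : Fin n → ℕ) : Function.Injective (scal (p := p) k) := by
  intro x y h
  ext1 i
  have := congrFun h i
  simp only [scal_apply] at this
  exact mul_left_cancel₀ (pow_ne_zero _ pne) this

lemma scal_cont (k : Fin n → ℕ) : Continuous (scal (p := p) k) := by
  change Continuous (fun z : Fin n → ℤ_[p] => fun i => (p : ℤ_[p]) ^ k i * z i)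
  fun_prop

lemma scal_emb (k : Fin n → ℕ) : MeasurableEmbedding (scal (p := p) k) :=
  ((scal_cont k).isClosedEmbedding (scal_inj k)).measurableEmbedding

/-- reduction mod `p^k` -/
noncomputable def redk (k : Fin n → ℕ) : (Fin n → ℤ_[p]) →+ (∀ i, ZMod (p ^ k i)) where
  toFun z := fun i => PadicInt.toZModPow (k i) (z i)
  map_zero' := by ext i; simp
  map_add' x y := by ext i; simp

lemma redk_surj (k : Fin n → ℕ) : Function.Surjective (redk (p := p) k) := by
  intro y
  choose f hf using fun i => ZMod.ringHom_surjective (PadicInt.toZModPow (p := p) (k i)) (y i)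
  exact ⟨f, by ext1 i; exact hf i⟩

lemma mem_range_scal (k : Fin n → ℕ) (z : Fin n → ℤ_[p]) :
    z ∈ Set.range (scal (p := p) k) ↔ ∀ i, (p : ℤ_[p]) ^ k i ∣ z i := by
  constructor
  · rintro ⟨w, rfl⟩ i
    exact ⟨w i, rfl⟩
  · intro h
    choose w hw using h
    exact ⟨w, by ext1 i; exact (hw i).symm⟩

lemma ker_redk (k : Fin n → ℕ) :
    ((redk (p := p) k).ker : Set (Fin n → ℤ_[p])) = Set.range (scal k) := by
  ext z
  rw [mem_range_scal]
  have : ∀ i, (p : ℤ_[p]) ^ k i ∣ z i ↔ PadicInt.toZModPow (k i) (z i) = 0 := by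
    intro i
    rw [← RingHom.mem_ker, PadicInt.ker_toZModPow, Ideal.mem_span_singleton]
  simp only [this]
  constructor
  · intro h i
    exact congrFun h i
  · intro h
    exact funext h

lemma measure_range_scal (k : Fin n → ℕ) :
    padicHaar p n (Set.range (scal k)) = ((p : ENNReal) ^ (∑ i, k i))⁻¹ := by
  have hp := (Fact.out : p.Prime).ne_zero
  have : ∀ i, NeZero (p ^ k i) := fun i => ⟨pow_ne_zero _ hp⟩
  have hidx : (redk (p := p) k).ker.index = p ^ (∑ i, k i) := by
    rw [AddSubgroup.index_ker, AddMonoidHom.range_eq_top.mpr (redk_surj k)]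
    rw [AddSubgroup.card_top, Nat.card_pi]
    simp [Finset.prod_pow_eq_pow_sum]
  have : (redk (p := p) k).ker.FiniteIndex := ⟨by rw [hidx]; exact pow_ne_zero _ hp⟩
  have hm : MeasurableSet ((redk (p := p) k).ker : Set (Fin n → ℤ_[p])) := by
    rw [ker_redk]; exact (scal_emb k).measurableSet_range
  have := AddSubgroup.index_mul_measure _ hm (padicHaar p n)
  rw [hidx, ker_redk, measure_univ] at this
  rw [ENNReal.eq_inv_of_mul_eq_one_left (a := padicHaar p n (Set.range (scal k))) (b := (p : ENNReal) ^ (∑ i, k i))]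
  rw [mul_comm]; exact_mod_cast this

lemma comap_scal (k : Fin n → ℕ) :
    (padicHaar p n).comap (scal k) = ((p : NNReal) ^ (∑ i, k i))⁻¹ • padicHaar p n := by
  set ν := (padicHaar p n).comap (scal k) with hν
  have happ : ∀ S, ν S = padicHaar p n (scal k '' S) := fun S => (scal_emb k).comap_apply _ _
  have : IsFiniteMeasure ν := ⟨by rw [happ]; exact measure_lt_top _ _⟩
  have : ν.IsAddLeftInvariant := by
    constructor
    intro g
    ext S hS
    rw [Measure.map_apply (measurable_const_add g) hS, happ, happ]
    rw [← measure_preimage_add (padicHaar p n) (scal k g) (scal k '' S)]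
    congr 1
    ext x
    constructor
    · rintro ⟨y, hy, rfl⟩
      exact ⟨g + y, hy, by simp⟩
    · rintro ⟨y, hy, h⟩
      refine ⟨y - g, ?_, ?_⟩
      · simpa using hy
      · rw [map_sub, h]; simp
  have key := Measure.isAddInvariant_eq_smul_of_compactSpace ν (padicHaar p n)
  have h1 : ν Set.univ = ((p : ENNReal) ^ (∑ i, k i))⁻¹ := by
    rw [happ, Set.image_univ, measure_range_scal]
  have h2 : ν Set.univ = (Measure.addHaarScalarFactor ν (padicHaar p n) : ENNReal) := by
    refine (congrArg (fun m : Measure (Fin n → ℤ_[p]) => m Set.univ) key).trans ?_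
    rw [Measure.smul_apply, measure_univ, ENNReal.smul_def, smul_eq_mul, mul_one]
  rw [key]
  congr 1
  have hp := (Fact.out : p.Prime).ne_zero
  rw [h1] at h2
  rw [← ENNReal.coe_inj, ← h2, ENNReal.coe_inv]
  · simp
  · exact pow_ne_zero _ (by exact_mod_cast hp)

/-- scaling change of variables -/
lemma setIntegral_range_scal (k : Fin n → ℕ) (φ : (Fin n → ℤ_[p]) → ℂ) :
    ∫ x in Set.range (scal k), φ x ∂(padicHaar p n)
      = ((p : ℂ) ^ (∑ i, k i))⁻¹ * ∫ z, φ (scal k z) ∂(padicHaar p n) := by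
  rw [← (scal_emb k).map_comap (padicHaar p n), (scal_emb k).integral_map, comap_scal,
    integral_smul_nnreal_measure]
  simp [NNReal.smul_def]

lemma isometry_surj {X : Type*} [MetricSpace X] [CompactSpace X] (ψ : X → X) (h : Isometry ψ) :
    Function.Surjective ψ := by
  intro y
  by_contra hy
  have hcl : IsClosed (Set.range ψ) := (isCompact_range h.continuous).isClosed
  have hy' : y ∈ (Set.range ψ)ᶜ := hy
  obtain ⟨ε, hε, hb⟩ := Metric.isOpen_iff.mp hcl.isOpen_compl y hy'
  have hfar : ∀ z, ε ≤ dist (ψ z) y := by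
    intro z
    by_contra hlt
    exact hb (Metric.mem_ball.mpr (not_le.mp hlt)) ⟨z, rfl⟩
  have hit : ∀ m, Isometry (ψ^[m]) := fun m => by
    induction m with
    | zero => exact isometry_id
    | succ m ih => exact ih.comp h
  obtain ⟨a, φ, hφ, ht⟩ := CompactSpace.tendsto_subseq (fun m => ψ^[m] y)
  have hc := ht.cauchySeq
  obtain ⟨N, hN⟩ := Metric.cauchySeq_iff.mp hc ε hε
  have h1 := hN (N+1) (by omega) N le_rfl
  have hlt : φ N < φ (N+1) := hφ (by omega)
  obtain ⟨d, hd⟩ := Nat.exists_eq_add_of_lt hlt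
  simp only [Function.comp] at h1
  rw [hd, show φ N + d + 1 = φ N + (d+1) from rfl, Function.iterate_add_apply, (hit _).dist_eq, Function.iterate_succ_apply'] at h1
  exact absurd h1 (not_lt.mpr (hfar _))

lemma isometry_mp (ψ : (Fin n → ℤ_[p]) → (Fin n → ℤ_[p])) (h : Isometry ψ) :
    MeasurePreserving ψ (padicHaar p n) (padicHaar p n) := by
  refine ⟨h.continuous.measurable, ?_⟩
  let C : Set (Set (Fin n → ℤ_[p])) := {S | S = ∅ ∨ ∃ x r, 0 < r ∧ S = Metric.ball x r}
  have : IsProbabilityMeasure ((padicHaar p n).map ψ) :=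
    Measure.isProbabilityMeasure_map h.continuous.measurable.aemeasurable
  have hbasis : TopologicalSpace.IsTopologicalBasis C := by
    refine TopologicalSpace.isTopologicalBasis_of_isOpen_of_nhds ?_ ?_
    · rintro u (rfl | ⟨x, r, -, rfl⟩)
      · exact isOpen_empty
      · exact Metric.isOpen_ball
    · intro a u ha hu
      obtain ⟨ε, hε, hb⟩ := Metric.isOpen_iff.mp hu a ha
      exact ⟨_, Or.inr ⟨a, ε, hε, rfl⟩, Metric.mem_ball_self hε, hb⟩
  have hgen : (inferInstance : MeasurableSpace (Fin n → ℤ_[p])) = MeasurableSpace.generateFrom C := by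
    rw [← hbasis.borel_eq_generateFrom]
    exact BorelSpace.measurable_eq
  refine ext_of_generate_finite C hgen ?_ ?_ (by simp)
  · rintro s (rfl | ⟨x, r, hr, rfl⟩) t (rfl | ⟨y, r', hr', rfl⟩) hne
    · simp at hne
    · simp at hne
    · simp at hne
    · right
      obtain ⟨z, hz1, hz2⟩ := hne
      refine ⟨z, min r r', lt_min hr hr', ?_⟩
      rw [IsUltrametricDist.ball_eq_of_mem hz1, IsUltrametricDist.ball_eq_of_mem hz2]
      ext w
      simp
  · rintro s (rfl | ⟨x, r, hr, rfl⟩)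
    · simp
    · obtain ⟨z, rfl⟩ := isometry_surj ψ h x
      rw [Measure.map_apply h.continuous.measurable Metric.isOpen_ball.measurableSet,
        h.preimage_ball]
      have := measure_preimage_add (padicHaar p n) (z - ψ z) (Metric.ball z r)
      rw [← this]
      congr 1
      ext w
      simp only [Set.mem_preimage, Metric.mem_ball, dist_eq_norm]
      rw [show z - ψ z + w - z = w - ψ z by abel]

end measure

section residues
variable {p : ℕ} [Fact p.Prime] {n : ℕ}

lemma toZMod_eq_zero_iff (x : ℤ_[p]) : PadicInt.toZMod x = 0 ↔ (p : ℤ_[p]) ∣ x := by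
  rw [← RingHom.mem_ker, PadicInt.ker_toZMod, PadicInt.maximalIdeal_eq_span_p,
    Ideal.mem_span_singleton]

/-- a lift of residues -/
noncomputable def lft (a : Fin n → ZMod p) : Fin n → ℤ_[p] := fun i => ((a i).val : ℤ_[p])

lemma toZMod_lft (a : Fin n → ZMod p) (i : Fin n) : PadicInt.toZMod (lft a i) = a i := by
  have : NeZero p := ⟨(Fact.out : p.Prime).ne_zero⟩
  simp [lft]

lemma toZMod_p : PadicInt.toZMod (p : ℤ_[p]) = 0 := by
  rw [toZMod_eq_zero_iff]

lemma continuous_toZMod_pre (a : ZMod p) : IsOpen {x : ℤ_[p] | PadicInt.toZMod x = a} := by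
  have : NeZero p := ⟨(Fact.out : p.Prime).ne_zero⟩
  have h : {x : ℤ_[p] | PadicInt.toZMod x = a} = Metric.ball ((a.val : ℤ_[p])) 1 := by
    ext x
    rw [Metric.mem_ball, dist_eq_norm, PadicInt.norm_lt_one_iff_dvd, ← toZMod_eq_zero_iff, Set.mem_ofPred_eq]
    rw [map_sub, sub_eq_zero]
    simp
  rw [h]; exact Metric.isOpen_ball

lemma integral_residues (φ : (Fin n → ℤ_[p]) → ℂ) (hφ : Integrable φ (padicHaar p n)) :
    ∫ x, φ x ∂(padicHaar p n) =
      ((p : ℂ) ^ n)⁻¹ * ∑ a : Fin n → ZMod p,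
        ∫ z, φ (fun i => lft a i + p * z i) ∂(padicHaar p n) := by
  have : NeZero p := ⟨(Fact.out : p.Prime).ne_zero⟩
  let R : (Fin n → ZMod p) → Set (Fin n → ℤ_[p]) := fun a => {x | ∀ i, PadicInt.toZMod (x i) = a i}
  have hRm : ∀ a, MeasurableSet (R a) := by
    intro a
    have : R a = ⋂ i, (fun x : Fin n → ℤ_[p] => x i) ⁻¹' {x : ℤ_[p] | PadicInt.toZMod x = a i} := by
      ext x; simp [R]
    rw [this]
    exact MeasurableSet.iInter fun i =>
      ((continuous_toZMod_pre (a i)).preimage (continuous_apply i)).measurableSet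
  have hun : (⋃ a, R a) = Set.univ := by
    ext x; simp only [Set.mem_iUnion, Set.mem_univ, iff_true]
    exact ⟨fun i => PadicInt.toZMod (x i), fun i => rfl⟩
  have hd : Pairwise (Function.onFun Disjoint R) := by
    intro a b hab
    rw [Function.onFun, Set.disjoint_left]
    intro x hx hy
    exact hab (funext fun i => (hx i).symm.trans (hy i))
  rw [← setIntegral_univ, ← hun, integral_iUnion_fintype hRm hd (fun i => hφ.integrableOn),
    Finset.mul_sum]
  refine Finset.sum_congr rfl fun a _ => ?_
  rw [← integral_indicator (hRm a), ← integral_add_left_eq_self _ (lft a)]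
  have h1 : (fun x => (R a).indicator φ (lft a + x)) =
      (Set.range (scal (p := p) (fun _ : Fin n => 1))).indicator (fun x => φ (lft a + x)) := by
    ext x
    have : lft a + x ∈ R a ↔ x ∈ Set.range (scal (p := p) (fun _ : Fin n => 1)) := by
      rw [mem_range_scal]
      refine forall_congr' fun i => ?_
      rw [Pi.add_apply, map_add, toZMod_lft, pow_one, ← toZMod_eq_zero_iff]
      simp
    by_cases hx : x ∈ Set.range (scal (p := p) (fun _ : Fin n => 1))
    · rw [Set.indicator_of_mem hx, Set.indicator_of_mem (this.mpr hx)]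
    · rw [Set.indicator_of_notMem hx, Set.indicator_of_notMem (fun h => hx (this.mp h))]
  rw [h1, integral_indicator (scal_emb _).measurableSet_range, setIntegral_range_scal]
  congr 1
  · simp
  · refine integral_congr_ae (Filter.Eventually.of_forall fun z => ?_)
    simp only
    congr 1
    ext1 i
    simp [scal_apply]

end residues

section taylor
variable {p : ℕ} [Fact p.Prime] {n : ℕ}

lemma taylor_aux {R : Type*} [CommRing R] (π : R) (a x y : Fin n → R)
    (hx : ∀ i, π ∣ x i - a i) (hy : ∀ i, π ∣ y i - a i) (h : MvPolynomial (Fin n) R) :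
    (π ∣ eval y h - eval a h) ∧
    ∃ d : Fin n → R, (∀ j, π ∣ d j - eval a (pderiv j h)) ∧
      eval x h - eval y h = ∑ j, d j * (x j - y j) := by
  induction h using MvPolynomial.induction_on with
  | C c => exact ⟨by simp, 0, by simp, by simp⟩
  | add f g hf hg =>
    obtain ⟨hf0, d, hd, hd'⟩ := hf
    obtain ⟨hg0, e, he, he'⟩ := hg
    refine ⟨?_, d + e, fun j => ?_, ?_⟩
    · rw [map_add, map_add, add_sub_add_comm]; exact dvd_add hf0 hg0
    · rw [Pi.add_apply, map_add, map_add, add_sub_add_comm]; exact dvd_add (hd j) (he j)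
    · rw [map_add, map_add, add_sub_add_comm, hd', he', ← Finset.sum_add_distrib]
      exact Finset.sum_congr rfl fun j _ => by simp [add_mul]
  | mul_X f i hf =>
    obtain ⟨hf0, d, hd, hd'⟩ := hf
    refine ⟨?_, fun j => x i * d j + Pi.single (M := fun _ => R) i (eval y f) j, fun j => ?_, ?_⟩
    · obtain ⟨u, hu⟩ := hf0
      obtain ⟨v, hv⟩ := hy i
      refine ⟨u * y i + eval a f * v, ?_⟩
      simp only [map_mul, eval_X]
      linear_combination (y i) * hu + eval a f * hv
    · obtain ⟨u, hu⟩ := hf0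
      obtain ⟨v, hv⟩ := hx i
      obtain ⟨w, hw⟩ := hd j
      rw [Derivation.leibniz, pderiv_X]
      by_cases hij : j = i
      · subst hij
        refine ⟨x j * w + v * eval a (pderiv j f) + u, ?_⟩
        simp only [Pi.single_eq_same, smul_eq_mul, map_add, map_mul, eval_X, mul_one]
        linear_combination (x j) * hw + eval a (pderiv j f) * hv + hu
      · refine ⟨x i * w + v * eval a (pderiv j f), ?_⟩
        simp only [Pi.single_eq_of_ne hij, Pi.single_eq_of_ne (Ne.symm hij), smul_eq_mul, map_add, map_mul, eval_X, mul_zero,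
          map_zero]
        linear_combination (x i) * hw + eval a (pderiv j f) * hv
    · simp only [map_mul, eval_X, add_mul, Finset.sum_add_distrib]
      have : ∑ j, Pi.single (M := fun _ => R) i (eval y f) j * (x j - y j) = eval y f * (x i - y i) := by
        rw [Finset.sum_eq_single i]
        · simp
        · intro b _ hb; simp [Pi.single_eq_of_ne hb]
        · simp
      rw [this]
      simp only [mul_assoc, ← Finset.mul_sum]
      rw [← hd']; ring

lemma norm_mulVec_le (D : Matrix (Fin n) (Fin n) ℤ_[p]) (v : Fin n → ℤ_[p]) :
    ‖D.mulVec v‖ ≤ ‖v‖ := by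
  rw [pi_norm_le_iff_of_nonneg (norm_nonneg _)]
  intro i
  rw [Matrix.mulVec, dotProduct]
  refine IsUltrametricDist.norm_sum_le_of_forall_le_of_nonneg (norm_nonneg _) fun j _ => ?_
  rw [norm_mul]
  calc ‖D i j‖ * ‖v j‖ ≤ 1 * ‖v j‖ := by gcongr; exact PadicInt.norm_le_one _
    _ ≤ ‖v‖ := by rw [one_mul]; exact norm_le_pi_norm v j

lemma key_square (a : Fin n → ℤ_[p]) (H : Fin n → MvPolynomial (Fin n) ℤ_[p])
    (h0 : ∀ i, (p : ℤ_[p]) ∣ eval a (H i))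
    (hdet : (Matrix.of fun i j => PadicInt.toZMod (eval a (pderiv j (H i)))).det ≠ 0) :
    ∃ ψ : (Fin n → ℤ_[p]) → (Fin n → ℤ_[p]),
      MeasurePreserving ψ (padicHaar p n) (padicHaar p n) ∧
      ∀ z i, eval (fun l => a l + p * z l) (H i) = p * ψ z i := by
  have hdv : ∀ (z : Fin n → ℤ_[p]) i, (p : ℤ_[p]) ∣ (a i + p * z i) - a i := by
    intro z i; rw [add_sub_cancel_left]; exact dvd_mul_right _ _
  have h1 : ∀ (z : Fin n → ℤ_[p]) i, (p : ℤ_[p]) ∣ eval (fun l => a l + p * z l) (H i) := by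
    intro z i
    have := (taylor_aux (p : ℤ_[p]) a (fun l => a l + p * z l) (fun l => a l + p * z l)
      (hdv z) (hdv z) (H i)).1
    exact (dvd_sub_left (h0 i)).mp this
  choose ψ hψ using h1
  refine ⟨ψ, isometry_mp ψ ?_, hψ⟩
  refine Isometry.of_dist_eq fun z w => ?_
  rw [dist_eq_norm, dist_eq_norm]
  choose D hD hD' using fun i => (taylor_aux (p : ℤ_[p]) a (fun l => a l + p * z l)
    (fun l => a l + p * w l) (hdv z) (hdv w) (H i)).2
  have hmv : ψ z - ψ w = (Matrix.of D).mulVec (z - w) := by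
    ext1 i
    have := hD' i
    rw [hψ, hψ] at this
    have h2 : ∑ j, D i j * (a j + p * z j - (a j + p * w j)) = p * ∑ j, D i j * (z j - w j) := by
      rw [Finset.mul_sum]; exact Finset.sum_congr rfl fun j _ => by ring
    rw [h2, ← mul_sub] at this
    exact mul_left_cancel₀ pne this
  have hu : IsUnit (Matrix.of D).det := by
    rw [PadicInt.isUnit_iff]
    by_contra hne
    have hlt : ‖(Matrix.of D).det‖ < 1 := lt_of_le_of_ne (PadicInt.norm_le_one _) hne
    rw [PadicInt.norm_lt_one_iff_dvd, ← toZMod_eq_zero_iff, RingHom.map_det] at hlt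
    apply hdet
    rw [← hlt]
    congr 1
    ext i j
    have := (toZMod_eq_zero_iff _).mpr (hD i j)
    rw [map_sub, sub_eq_zero] at this
    simp [this]
  rw [hmv]
  refine le_antisymm (norm_mulVec_le _ _) ?_
  calc ‖z - w‖ = ‖((Matrix.of D)⁻¹).mulVec ((Matrix.of D).mulVec (z - w))‖ := by
        rw [Matrix.mulVec_mulVec, Matrix.nonsing_inv_mul _ hu, Matrix.one_mulVec]
    _ ≤ _ := norm_mulVec_le _ _

lemma sumExtend_inl {K V ι : Type*} [DivisionRing K] [AddCommGroup V] [Module K V] {v : ι → V}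
    (hs : LinearIndependent K v) (i : ι) : Module.Basis.sumExtend hs (Sum.inl i) = v i := by
  simp only [Module.Basis.sumExtend, Module.Basis.reindex_apply, Module.Basis.extend_apply_self]
  rfl

lemma key {ι : Type} [Fintype ι] (a : Fin n → ℤ_[p]) (h : ι → MvPolynomial (Fin n) ℤ_[p])
    (h0 : ∀ i, (p : ℤ_[p]) ∣ eval a (h i))
    (hli : LinearIndependent (ZMod p)
      (fun (i : ι) (j : Fin n) => PadicInt.toZMod (eval a (pderiv j (h i))))) :
    ∃ (σ : ι → Fin n) (ψ : (Fin n → ℤ_[p]) → (Fin n → ℤ_[p])), Function.Injective σ ∧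
      MeasurePreserving ψ (padicHaar p n) (padicHaar p n) ∧
      ∀ z i, eval (fun l => a l + p * z l) (h i) = p * ψ z (σ i) := by
  classical
  let b := Module.Basis.sumExtend hli
  have hfin : Finite (ι ⊕ Module.Basis.sumExtendIndex hli) := Module.Finite.finite_basis b
  have : Fintype (ι ⊕ Module.Basis.sumExtendIndex hli) := Fintype.ofFinite _
  have hcard : Fintype.card (ι ⊕ Module.Basis.sumExtendIndex hli) = Fintype.card (Fin n) := by
    rw [← Module.finrank_eq_card_basis b]; simp
  let e := Fintype.equivOfCardEq hcard
  let b' := b.reindex e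
  let H : ι ⊕ Module.Basis.sumExtendIndex hli → MvPolynomial (Fin n) ℤ_[p] :=
    Sum.elim h (fun s => ∑ l, C (lft (b (Sum.inr s)) l) * (X l - C (a l)))
  have hH : ∀ c j, PadicInt.toZMod (eval a (pderiv j (H c))) = b c j := by
    rintro (i | s) j
    · have : b (Sum.inl i) = _ := sumExtend_inl hli i
      rw [this]; rfl
    · simp only [H, Sum.elim_inr, map_sum, Derivation.leibniz, pderiv_C, map_sub, pderiv_X, map_add,
        smul_eq_mul, map_mul, eval_C, eval_X, sub_zero, mul_zero, add_zero, map_zero]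
      rw [Finset.sum_eq_single j]
      · simp [toZMod_lft]
      · intro l _ hl; simp [Pi.single_eq_of_ne hl, Pi.single_eq_of_ne (Ne.symm hl)]
      · simp
  obtain ⟨ψ, hψ, hψ'⟩ := key_square a (fun i => H (e.symm i)) (by
      intro i
      rcases e.symm i with i | s
      · exact h0 i
      · simp [H]) (by
      have : (Matrix.of fun i j => PadicInt.toZMod (eval a (pderiv j (H (e.symm i)))))
          = Matrix.of (fun i => b' i) := by
        ext i j
        simp [hH, b']
      rw [this, ← isUnit_iff_ne_zero, ← Matrix.isUnit_iff_isUnit_det,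
        ← Matrix.linearIndependent_rows_iff_isUnit]
      exact b'.linearIndependent)
  refine ⟨fun i => e (Sum.inl i), ψ, fun i j hij => by simpa using hij, hψ, fun z i => ?_⟩
  rw [← hψ' z (e (Sum.inl i))]
  simp [H]

end taylor

section base
variable {p : ℕ} [Fact p.Prime] {n t : ℕ}

lemma iSup_norm_eq (v : Fin t → ℤ_[p]) : (⨆ i, ‖v i‖) = ‖v‖ := by
  rcases isEmpty_or_nonempty (Fin t) with h | h
  · rw [Real.iSup_of_isEmpty, Subsingleton.elim v 0, norm_zero]
  · refine le_antisymm (ciSup_le fun i => norm_le_pi_norm v i) ?_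
    rw [pi_norm_le_iff_of_nonempty]
    exact fun i => le_ciSup (f := fun i => ‖v i‖) (Set.finite_range _).bddAbove i

lemma mapNorm_eq (F : Fin t → MvPolynomial (Fin n) ℤ_[p]) (x : Fin n → ℤ_[p]) :
    mapNorm F x = ‖fun i => eval x (F i)‖ := iSup_norm_eq _

lemma norm_p_mul (c : ℕ) (v : Fin t → ℤ_[p]) :
    ‖fun i => (p : ℤ_[p]) ^ c * v i‖ = (((p : ℝ) ^ c)⁻¹) * ‖v‖ := by
  rw [← iSup_norm_eq, ← iSup_norm_eq, Real.mul_iSup_of_nonneg (by positivity)]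
  simp

lemma pi_norm_le_one (v : Fin t → ℤ_[p]) : ‖v‖ ≤ 1 := by
  rw [pi_norm_le_iff_of_nonneg zero_le_one]
  exact fun i => PadicInt.norm_le_one _

lemma pi_norm_eq_one (v : Fin t → ℤ_[p]) (h : ∃ i, ¬ (p : ℤ_[p]) ∣ v i) : ‖v‖ = 1 := by
  obtain ⟨i, hi⟩ := h
  refine le_antisymm (pi_norm_le_one v) ?_
  rw [← PadicInt.norm_lt_one_iff_dvd, not_lt] at hi
  exact hi.trans (norm_le_pi_norm v i)

lemma p_gt_one : (1 : ℝ) < p := by exact_mod_cast (Fact.out : p.Prime).one_lt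

lemma cpow_inv_mul (c : ℕ) (s : ℂ) (r : ℝ) (hr : 0 ≤ r) :
    (((((p : ℝ) ^ c)⁻¹ * r : ℝ)) : ℂ) ^ s = (p : ℂ) ^ (-(c : ℂ) * s) * (r : ℂ) ^ s := by
  have hp := p_gt_one (p := p)
  have hp0 : (p : ℂ) ≠ 0 := by exact_mod_cast (Fact.out : p.Prime).ne_zero
  rw [Complex.ofReal_mul, Complex.mul_cpow_ofReal_nonneg (by positivity) hr]
  congr 1
  have h1 : (((p : ℝ) ^ c)⁻¹ : ℝ) = (p : ℝ) ^ (-(c : ℝ)) := by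
    rw [Real.rpow_neg (by positivity), Real.rpow_natCast]
  rw [h1]
  have h2 := Complex.cpow_mul_ofReal_nonneg (x := (p : ℝ)) (by positivity) (-(c : ℝ)) s
  rw [← h2]
  push_cast
  rfl

lemma norm_cpow_le_one (s : ℂ) (hs : 0 < s.re) (r : ℝ) (h0 : 0 ≤ r) (h1 : r ≤ 1) :
    ‖(r : ℂ) ^ s‖ ≤ 1 := by
  rw [Complex.norm_cpow_eq_rpow_re_of_nonneg h0 hs.ne']
  exact Real.rpow_le_one h0 h1 hs.le

lemma q_ne (s : ℂ) (hs : 0 < s.re) : (p : ℂ) ^ s * (p : ℂ) ^ t - 1 ≠ 0 := by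
  intro h
  rw [sub_eq_zero] at h
  have h1 := congrArg norm h
  rw [norm_mul, Complex.norm_natCast_cpow_of_pos (Fact.out : p.Prime).pos, norm_pow, norm_one] at h1
  have hp := p_gt_one (p := p)
  have h2 : 1 < (p : ℝ) ^ s.re := Real.one_lt_rpow hp hs
  have h3 : 1 ≤ ‖(p : ℂ)‖ ^ t := one_le_pow₀ (by simpa using hp.le)
  nlinarith

lemma base_int (s : ℂ) (hs : 0 < s.re) (σ : Fin t → Fin n) (hσ : Function.Injective σ)
    (w : (Fin n → ℤ_[p]) → ℂ) (hw : Integrable w (padicHaar p n))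
    (hinv : ∀ z z' : Fin n → ℤ_[p], (∀ i, i ∉ Set.range σ → z i = z' i) → w z = w z') :
    ∫ z, ((‖fun i => (p : ℤ_[p]) * z (σ i)‖ : ℝ) : ℂ) ^ s * w z ∂(padicHaar p n) =
      ((p : ℂ) ^ t - 1) / ((p : ℂ) ^ s * (p : ℂ) ^ t - 1) * ∫ z, w z ∂(padicHaar p n) := by
  classical
  have hp := p_gt_one (p := p)
  have hp0 : (p : ℂ) ≠ 0 := by exact_mod_cast (Fact.out : p.Prime).ne_zero
  set k : Fin n → ℕ := fun i => if i ∈ Set.range σ then 1 else 0 with hk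
  have hksum : ∑ i, k i = t := by
    rw [hk, Finset.sum_ite]
    simp only [Finset.sum_const, smul_eq_mul, mul_one, mul_zero, add_zero]
    have : Finset.univ.filter (fun i => i ∈ Set.range σ) = Finset.univ.image σ := by
      ext i; simp
    rw [this, Finset.card_image_of_injective _ hσ]; simp
  have hks : ∀ i, k (σ i) = 1 := fun i => by simp [hk]
  set f : (Fin n → ℤ_[p]) → ℂ := fun z => ((‖fun i => z (σ i)‖ : ℝ) : ℂ) ^ s with hf
  have hfc : Continuous f := by
    refine (Complex.continuous_ofReal_cpow_const hs).comp ?_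
    fun_prop
  have hfw : Integrable (fun z => f z * w z) (padicHaar p n) :=
    hw.bdd_mul (c := 1) hfc.aestronglyMeasurable (Filter.Eventually.of_forall fun z =>
      norm_cpow_le_one s hs _ (norm_nonneg _) (pi_norm_le_one _))
  have hwk : ∀ z, w (scal k z) = w z := by
    intro z
    apply hinv
    intro i hi
    rw [scal_apply, hk]
    simp only [if_neg hi, pow_zero, one_mul]
  have hfk : ∀ z, f (scal k z) = ((p : ℂ) ^ s)⁻¹ * f z := by
    intro z
    have h1 := norm_p_mul 1 (fun i => z (σ i))
    simp only [hf, scal_apply, hks]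
    rw [h1, cpow_inv_mul 1 s _ (norm_nonneg _), ← Complex.cpow_neg]
    simp
  have hf1 : ∀ z, z ∉ Set.range (scal (p := p) k) → f z = 1 := by
    intro z hz
    rw [mem_range_scal] at hz
    push Not at hz
    obtain ⟨i, hi⟩ := hz
    have : ‖fun i => z (σ i)‖ = 1 := by
      apply pi_norm_eq_one
      by_cases hir : i ∈ Set.range σ
      · obtain ⟨j, rfl⟩ := hir
        exact ⟨j, by simpa [hks] using hi⟩
      · exfalso; apply hi; simp only [hk, if_neg hir, pow_zero]; exact one_dvd _
    simp [hf, this]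
  have hm := (scal_emb (p := p) k).measurableSet_range
  have e1 := integral_add_compl hm hfw
  have e2 := integral_add_compl hm hw
  have e3 := setIntegral_congr_fun (μ := padicHaar p n) hm.compl (f := fun z => f z * w z) (g := w)
    (fun z hz => by simp only [hf1 z hz, one_mul])
  rw [setIntegral_range_scal] at e1 e2
  simp only [hwk, hfk, hksum] at e1 e2
  simp only [mul_assoc, integral_const_mul] at e1
  rw [e3] at e1
  have hgoal : ∫ z, ((‖fun i => (p : ℤ_[p]) * z (σ i)‖ : ℝ) : ℂ) ^ s * w z ∂(padicHaar p n)
      = ((p : ℂ) ^ s)⁻¹ * ∫ z, f z * w z ∂(padicHaar p n) := by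
    rw [← integral_const_mul]
    refine integral_congr_ae (Filter.Eventually.of_forall fun z => ?_)
    have h1 := norm_p_mul 1 (fun i => z (σ i))
    simp only [pow_one] at h1
    simp only [hf]
    have h2 := cpow_inv_mul (p := p) 1 s ‖fun i => z (σ i)‖ (norm_nonneg _)
    rw [pow_one] at h2
    rw [h1, h2, ← Complex.cpow_neg]
    simp [mul_assoc]
  rw [hgoal]
  have hq := q_ne (p := p) (t := t) s hs
  have hq0 : (p : ℂ) ^ s ≠ 0 := by simp [Complex.cpow_eq_zero_iff, hp0]
  have hpt : (p : ℂ) ^ t ≠ 0 := pow_ne_zero _ hp0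
  generalize (∫ z, f z * w z ∂(padicHaar p n)) = I at *
  generalize (∫ z, w z ∂(padicHaar p n)) = W at *
  generalize (∫ z in (Set.range (scal (p := p) k))ᶜ, w z ∂(padicHaar p n)) = V at *
  generalize (p : ℂ) ^ s = q at *
  generalize (p : ℂ) ^ t = T at *
  have : V = W - T⁻¹ * W := by linear_combination e2
  subst this
  rw [div_mul_eq_mul_div, eq_div_iff hq]
  field_simp at e1 ⊢
  linear_combination -e1

lemma base_one (j : Fin n) :
    ∫ z, ((‖(p : ℤ_[p]) * z j‖ : ℝ) : ℂ) ∂(padicHaar p n) = 1 / ((p : ℂ) + 1) := by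
  have h := base_int (p := p) (n := n) (t := 1) 1 (by simp) (fun _ => j)
    (Function.injective_of_subsingleton _) (fun _ => 1) (integrable_const _) (fun _ _ _ => rfl)
  have hp := p_gt_one (p := p)
  have h1 : (p : ℂ) - 1 ≠ 0 := by
    rw [sub_ne_zero]; exact_mod_cast hp.ne'
  have h2 : (p : ℂ) + 1 ≠ 0 := by exact_mod_cast Nat.succ_ne_zero p
  have h3 : ((p : ℂ) ^ 1 - 1) / ((p : ℂ) ^ (1 : ℂ) * (p : ℂ) ^ 1 - 1) = 1 / ((p : ℂ) + 1) := by
    rw [Complex.cpow_one, pow_one, show (p : ℂ) * p - 1 = (p - 1) * (p + 1) by ring]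
    field_simp
  rw [h3] at h
  simp only [Complex.cpow_one, mul_one] at h
  simp only [integral_const, probReal_univ, one_smul, mul_one] at h
  rw [← h]
  refine integral_congr_ae (Filter.Eventually.of_forall fun z => ?_)
  simp only
  rw [← iSup_norm_eq]
  simp

/-- local factors -/
noncomputable def cA (p t : ℕ) (s : ℂ) : ℂ := ((p : ℂ) ^ t - 1) / ((p : ℂ) ^ s * (p : ℂ) ^ t - 1)

open Classical in
lemma local_int (s : ℂ) (hs : 0 < s.re) (a : Fin n → ℤ_[p])
    (h : Fin t → MvPolynomial (Fin n) ℤ_[p]) (G : MvPolynomial (Fin n) ℤ_[p])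
    (hA : (∀ i, (p : ℤ_[p]) ∣ eval a (h i)) → LinearIndependent (ZMod p)
      (fun (i : Fin t) (j : Fin n) => PadicInt.toZMod (eval a (pderiv j (h i)))))
    (hB : (p : ℤ_[p]) ∣ eval a G → LinearIndependent (ZMod p)
      (fun (_ : Fin 1) (j : Fin n) => PadicInt.toZMod (eval a (pderiv j G))))
    (hAB : (∀ i, (p : ℤ_[p]) ∣ eval a (h i)) → (p : ℤ_[p]) ∣ eval a G →
      LinearIndependent (ZMod p) (fun (i : Option (Fin t)) (j : Fin n) =>
        PadicInt.toZMod (eval a (pderiv j (i.elim G h))))) :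
    ∫ z : Fin n → ℤ_[p], (mapNorm h (fun l => a l + p * z l) : ℂ) ^ s
        * (‖eval (fun l => a l + p * z l) G‖ : ℂ) ∂(padicHaar p n) =
      (if ∀ i, (p : ℤ_[p]) ∣ eval a (h i) then cA p t s else 1) *
      (if (p : ℤ_[p]) ∣ eval a G then 1 / ((p : ℂ) + 1) else 1) := by
  have hdv : ∀ (z : Fin n → ℤ_[p]) i, (p : ℤ_[p]) ∣ (a i + p * z i) - a i := by
    intro z i; rw [add_sub_cancel_left]; exact dvd_mul_right _ _
  have hcong : ∀ (z : Fin n → ℤ_[p]) (f : MvPolynomial (Fin n) ℤ_[p]), (p : ℤ_[p]) ∣ eval (fun l => a l + p * z l) f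
      → (p : ℤ_[p]) ∣ eval a f := by
    intro z f hf
    have := (taylor_aux (p : ℤ_[p]) a (fun l => a l + p * z l) (fun l => a l + p * z l)
      (hdv z) (hdv z) f).1
    exact (dvd_sub_right hf).mp this
  have hnF : (¬ ∀ i, (p : ℤ_[p]) ∣ eval a (h i)) → ∀ z : Fin n → ℤ_[p],
      mapNorm h (fun l => a l + p * z l) = 1 := by
    intro hn z
    push Not at hn
    obtain ⟨i, hi⟩ := hn
    rw [mapNorm_eq]
    exact pi_norm_eq_one _ ⟨i, fun h' => hi (hcong z _ h')⟩
  have hnG : (¬ (p : ℤ_[p]) ∣ eval a G) → ∀ z : Fin n → ℤ_[p],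
      ‖eval (fun l => a l + p * z l) G‖ = 1 := by
    intro hn z
    refine le_antisymm (PadicInt.norm_le_one _) ?_
    by_contra hlt
    rw [not_le, PadicInt.norm_lt_one_iff_dvd] at hlt
    exact hn (hcong z _ hlt)
  have hcb : ∀ ψ : (Fin n → ℤ_[p]) → (Fin n → ℤ_[p]),
      MeasurePreserving ψ (padicHaar p n) (padicHaar p n) → ∀ φ : (Fin n → ℤ_[p]) → ℂ,
      Continuous φ → ∫ z, φ (ψ z) ∂(padicHaar p n) = ∫ z, φ z ∂(padicHaar p n) := by
    intro ψ hψ φ hφ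
    conv_rhs => rw [← hψ.map_eq]
    rw [integral_map hψ.measurable.aemeasurable hφ.aestronglyMeasurable]
  have hcF : ∀ σ : Fin t → Fin n, Continuous (fun z : Fin n → ℤ_[p] =>
      ((‖fun i => (p : ℤ_[p]) * z (σ i)‖ : ℝ) : ℂ) ^ s) := by
    intro σ
    refine (Complex.continuous_ofReal_cpow_const hs).comp ?_
    fun_prop
  have hcG : ∀ j : Fin n, Continuous (fun z : Fin n → ℤ_[p] =>
      ((‖(p : ℤ_[p]) * z j‖ : ℝ) : ℂ)) := by
    intro j
    refine Complex.continuous_ofReal.comp ?_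
    fun_prop
  by_cases h1 : ∀ i, (p : ℤ_[p]) ∣ eval a (h i) <;> by_cases h2 : (p : ℤ_[p]) ∣ eval a G
  · rw [if_pos h1, if_pos h2]
    obtain ⟨σ, ψ, hσ, hψ, he⟩ := key a (fun i : Option (Fin t) => i.elim G h)
      (by rintro (_ | i); exacts [h2, h1 i]) (hAB h1 h2)
    have e1 : ∀ z i, eval (fun l => a l + p * z l) (h i) = p * ψ z (σ (some i)) :=
      fun z i => he z (some i)
    have e2 : ∀ z, eval (fun l => a l + p * z l) G = p * ψ z (σ none) := fun z => he z none
    simp only [mapNorm_eq, e1, e2]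
    rw [hcb ψ hψ (fun z => ((‖fun i => (p : ℤ_[p]) * z (σ (some i))‖ : ℝ) : ℂ) ^ s *
      ((‖(p : ℤ_[p]) * z (σ none)‖ : ℝ) : ℂ)) ((hcF _).mul (hcG _))]
    rw [base_int s hs (fun i => σ (some i)) (fun i j hij => Option.some_injective _ (hσ hij))
      (fun z => ((‖(p : ℤ_[p]) * z (σ none)‖ : ℝ) : ℂ)), base_one]
    · rfl
    · exact (hcG _).integrable_of_hasCompactSupport (HasCompactSupport.of_compactSpace _)
    · intro z z' hz
      rw [hz]
      rintro ⟨i, hi⟩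
      have := hσ hi
      simp at this
  · rw [if_pos h1, if_neg h2]
    obtain ⟨σ, ψ, hσ, hψ, he⟩ := key a h h1 (hA h1)
    simp only [mapNorm_eq, he, hnG h2]
    rw [hcb ψ hψ (fun z => ((‖fun i => (p : ℤ_[p]) * z (σ i)‖ : ℝ) : ℂ) ^ s *
      ((1 : ℝ) : ℂ)) ((hcF _).mul continuous_const)]
    rw [base_int s hs σ hσ (fun z => ((1 : ℝ) : ℂ)) (integrable_const _) (fun _ _ _ => rfl)]
    simp [cA]
  · rw [if_neg h1, if_pos h2]
    obtain ⟨σ, ψ, hσ, hψ, he⟩ := key a (fun _ : Fin 1 => G) (fun _ => h2) (hB h2)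
    have he' := fun z => he z 0
    simp only [hnF h1, he', Complex.ofReal_one, Complex.one_cpow, one_mul]
    rw [hcb ψ hψ (fun z => ((‖(p : ℤ_[p]) * z (σ 0)‖ : ℝ) : ℂ)) (hcG _), base_one]
  · rw [if_neg h1, if_neg h2]
    simp only [hnF h1, hnG h2]
    simp

end base

section newton
variable {n : ℕ}

/-- Newton polyhedron of a finite set of exponents -/
def NP (S : Finset (Fin n →₀ ℕ)) : Set (Fin n → ℝ) :=
  convexHull ℝ (⋃ ω ∈ S, (fun c => toR ω + c) '' orthant n)

/-- dot product -/
def dt (k x : Fin n → ℝ) : ℝ := ∑ i, k i * x i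

lemma dt_add (k x y : Fin n → ℝ) : dt k (x + y) = dt k x + dt k y := by
  simp [dt, mul_add, Finset.sum_add_distrib]

lemma dt_smul (k : Fin n → ℝ) (c : ℝ) (x : Fin n → ℝ) : dt k (c • x) = c * dt k x := by
  simp only [dt, Pi.smul_apply, smul_eq_mul, Finset.mul_sum]
  exact Finset.sum_congr rfl fun i _ => by ring

lemma dt_nonneg {k x : Fin n → ℝ} (hk : k ∈ orthant n) (hx : x ∈ orthant n) : 0 ≤ dt k x :=
  Finset.sum_nonneg fun i _ => mul_nonneg (hk i) (hx i)

lemma toR_mem_NP {S : Finset (Fin n →₀ ℕ)} {ω} (h : ω ∈ S) : toR ω ∈ NP S := by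
  apply subset_convexHull
  simp only [Set.mem_iUnion]
  exact ⟨ω, h, 0, fun i => le_rfl, by simp⟩

lemma NP_lower {S : Finset (Fin n →₀ ℕ)} {k : Fin n → ℝ} (hk : k ∈ orthant n) (m : ℝ)
    (hm : ∀ ω ∈ S, m ≤ dt k (toR ω)) : ∀ x ∈ NP S, m ≤ dt k x := by
  have : NP S ⊆ {x | m ≤ dt k x} := by
    apply convexHull_min
    · intro x hx
      simp only [Set.mem_iUnion] at hx
      obtain ⟨ω, hω, c, hc, rfl⟩ := hx
      have h1 := hm ω hω
      have h2 := dt_nonneg hk hc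
      change m ≤ dt k (toR ω + c)
      rw [dt_add]; linarith
    · intro x hx y hy a b ha hb hab
      change m ≤ dt k x at hx
      change m ≤ dt k y at hy
      change m ≤ dt k (a • x + b • y)
      rw [dt_add, dt_smul, dt_smul]
      have : b = 1 - a := by linarith
      subst this
      nlinarith
  exact this

lemma mP_isLeast {S : Finset (Fin n →₀ ℕ)} (hS : S.Nonempty) {k : Fin n → ℝ} (hk : k ∈ orthant n) :
    ∃ ω ∈ S, dt k (toR ω) = mP (NP S) k ∧ ∀ x ∈ NP S, mP (NP S) k ≤ dt k x := by
  obtain ⟨ω, hω, hmin⟩ := S.exists_min_image (fun ω => dt k (toR ω)) hS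
  have hl := NP_lower hk _ hmin
  have : mP (NP S) k = dt k (toR ω) := by
    refine IsLeast.csInf_eq ⟨⟨toR ω, toR_mem_NP hω, rfl⟩, ?_⟩
    rintro _ ⟨x, hx, rfl⟩
    exact hl x hx
  exact ⟨ω, hω, this.symm, by rw [this]; exact hl⟩

lemma mem_faceOf {S : Finset (Fin n →₀ ℕ)} {k : Fin n → ℝ} {ω} (h : ω ∈ S) :
    toR ω ∈ faceOf (NP S) k ↔ dt k (toR ω) = mP (NP S) k :=
  ⟨fun hx => hx.2, fun hx => ⟨toR_mem_NP h, hx⟩⟩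

lemma face_sub {S : Finset (Fin n →₀ ℕ)} (hS : S.Nonempty) {k k' : Fin n → ℝ}
    (hk : k ∈ orthant n)
    (hW : ∀ ω ∈ S, dt k (toR ω) = mP (NP S) k → dt k' (toR ω) = mP (NP S) k')
    (hI : ∀ i, k i = 0 → k' i = 0) : faceOf (NP S) k ⊆ faceOf (NP S) k' := by
  obtain ⟨ω0, hω0, h0, hl⟩ := mP_isLeast hS hk
  have key : NP S ⊆ {x | mP (NP S) k ≤ dt k x ∧ (dt k x = mP (NP S) k → dt k' x = mP (NP S) k')} := by
    apply convexHull_min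
    · intro x hx
      have hx' : x ∈ NP S := subset_convexHull _ _ hx
      refine ⟨hl x hx', ?_⟩
      simp only [Set.mem_iUnion] at hx
      obtain ⟨ω, hω, c, hc, rfl⟩ := hx
      intro he
      simp only [dt_add] at he ⊢
      have h1 := hl _ (toR_mem_NP hω)
      have h2 := dt_nonneg hk hc
      have h3 : dt k c = 0 := by linarith
      have h4 : dt k (toR ω) = mP (NP S) k := by linarith
      rw [hW ω hω h4]
      have h5 := (Finset.sum_eq_zero_iff_of_nonneg (fun i _ => mul_nonneg (hk i) (hc i))).mp h3
      have h6 : dt k' c = 0 := by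
        refine Finset.sum_eq_zero fun i hi => ?_
        rcases mul_eq_zero.mp (h5 i hi) with h | h
        · rw [hI i h, zero_mul]
        · rw [h, mul_zero]
      rw [h6, add_zero]
    · rintro x ⟨hx, hx'⟩ y ⟨hy, hy'⟩ a b ha hb hab
      have hb' : b = 1 - a := by linarith
      refine ⟨?_, ?_⟩
      · rw [dt_add, dt_smul, dt_smul]
        subst hb'; nlinarith
      · intro he
        rw [dt_add, dt_smul, dt_smul] at he ⊢
        rcases ha.eq_or_lt with h | h
        · subst h
          have : b = 1 := by linarith
          subst this
          simp only [zero_mul, one_mul, zero_add] at he ⊢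
          exact hy' he
        · rcases hb.eq_or_lt with h' | h'
          · subst h'
            have : a = 1 := by linarith
            subst this
            simp only [zero_mul, one_mul, add_zero] at he ⊢
            exact hx' he
          · have e1 : dt k x = mP (NP S) k := by
              subst hb'
              nlinarith
            have e2 : dt k y = mP (NP S) k := by
              subst hb'
              nlinarith
            rw [hx' e1, hy' e2, ← add_mul, hab, one_mul]
  rintro x ⟨hx, hx'⟩
  exact ⟨hx, (key hx).2 hx'⟩

lemma face_eq {S : Finset (Fin n →₀ ℕ)} (hS : S.Nonempty) {k k' : Fin n → ℝ}
    (hk : k ∈ orthant n) (hk' : k' ∈ orthant n)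
    (hW : ∀ ω ∈ S, dt k (toR ω) = mP (NP S) k ↔ dt k' (toR ω) = mP (NP S) k')
    (hI : ∀ i, k i = 0 ↔ k' i = 0) : faceOf (NP S) k = faceOf (NP S) k' :=
  Set.Subset.antisymm (face_sub hS hk (fun ω h => (hW ω h).mp) (fun i => (hI i).mp))
    (face_sub hS hk' (fun ω h => (hW ω h).mpr) (fun i => (hI i).mpr))

/-- natural dot product -/
def dN (k : Fin n → ℕ) (ω : Fin n →₀ ℕ) : ℕ := ∑ i, k i * ω i

lemma dt_toRn (k : Fin n → ℕ) (ω : Fin n →₀ ℕ) : dt (toRn k) (toR ω) = (dN k ω : ℝ) := by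
  simp [dt, dN, toRn, toR]

lemma toRn_mem (k : Fin n → ℕ) : toRn k ∈ orthant n := fun i => Nat.cast_nonneg _

/-- natural version of `m` -/
noncomputable def mN (S : Finset (Fin n →₀ ℕ)) (k : Fin n → ℕ) : ℕ := sInf (dN k '' S)

lemma mN_le {S : Finset (Fin n →₀ ℕ)} (k : Fin n → ℕ) {ω} (h : ω ∈ S) : mN S k ≤ dN k ω :=
  Nat.sInf_le ⟨ω, h, rfl⟩

lemma mP_eq_mN {S : Finset (Fin n →₀ ℕ)} (hS : S.Nonempty) (k : Fin n → ℕ) :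
    mP (NP S) (toRn k) = mN S k := by
  obtain ⟨ω, hω, h1, h2⟩ := mP_isLeast hS (toRn_mem k)
  have hne : (dN k '' (S : Set (Fin n →₀ ℕ))).Nonempty := ⟨_, ω, hω, rfl⟩
  obtain ⟨ω', hω', h'⟩ := Nat.sInf_mem hne
  refine le_antisymm ?_ ?_
  · have := h2 _ (toR_mem_NP hω')
    rw [dt_toRn, h'] at this
    exact this
  · rw [← h1, dt_toRn]
    exact_mod_cast mN_le k hω

variable {p : ℕ} [Fact p.Prime] {t : ℕ}

/-- joint support -/
noncomputable def suppF (F : Fin t → MvPolynomial (Fin n) ℤ_[p]) : Finset (Fin n →₀ ℕ) :=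
  Finset.univ.biUnion fun i => (F i).support

lemma newtonPolyMap_eq (F : Fin t → MvPolynomial (Fin n) ℤ_[p]) :
    newtonPolyMap F = NP (suppF F) := by
  unfold newtonPolyMap NP suppF
  congr 1
  ext x
  simp only [Set.mem_iUnion, Finset.mem_biUnion, Finset.mem_univ, true_and]
  constructor
  · rintro ⟨i, ω, hω, h⟩; exact ⟨ω, ⟨i, hω⟩, h⟩
  · rintro ⟨ω, ⟨i, hω⟩, h⟩; exact ⟨i, ω, hω, h⟩

lemma newtonPoly_eq (g : MvPolynomial (Fin n) ℤ_[p]) : newtonPoly g = NP g.support := rfl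

/-- rescaled polynomial -/
noncomputable def hpol (S : Finset (Fin n →₀ ℕ)) (k : Fin n → ℕ) (f : MvPolynomial (Fin n) ℤ_[p]) :
    MvPolynomial (Fin n) ℤ_[p] :=
  ∑ ω ∈ f.support, monomial ω (f.coeff ω * (p : ℤ_[p]) ^ (dN k ω - mN S k))

lemma eval_hpol (S : Finset (Fin n →₀ ℕ)) (k : Fin n → ℕ) (f : MvPolynomial (Fin n) ℤ_[p])
    (hf : f.support ⊆ S) (u : Fin n → ℤ_[p]) :
    eval (scal k u) f = (p : ℤ_[p]) ^ (mN S k) * eval u (hpol S k f) := by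
  rw [hpol, eval_eq', map_sum, Finset.mul_sum]
  refine Finset.sum_congr rfl fun ω hω => ?_
  rw [eval_monomial, Finsupp.prod_fintype _ _ (by simp)]
  simp only [scal_apply, mul_pow, Finset.prod_mul_distrib, ← pow_mul]
  rw [Finset.prod_pow_eq_pow_sum]
  have h1 : (p : ℤ_[p]) ^ (∑ i, k i * ω i) = (p : ℤ_[p]) ^ mN S k * (p : ℤ_[p]) ^ (dN k ω - mN S k) := by
    rw [← pow_add]; congr 1
    have := mN_le k (hf hω)
    unfold dN at this ⊢
    omega
  rw [h1]; ring

open Classical in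
lemma redp_hpol (S : Finset (Fin n →₀ ℕ)) (hS : S.Nonempty) (k : Fin n → ℕ)
    (f : MvPolynomial (Fin n) ℤ_[p]) (hf : f.support ⊆ S) :
    redp (hpol S k f) = redp ((f.support.filter
      (fun ω => toR ω ∈ faceOf (NP S) (toRn k))).sum (fun ω => monomial ω (f.coeff ω))) := by
  rw [hpol, redp, redp, map_sum, map_sum, Finset.sum_filter]
  refine Finset.sum_congr rfl fun ω hω => ?_
  rw [mem_faceOf (hf hω), dt_toRn, mP_eq_mN hS]
  have := mN_le k (hf hω)
  split_ifs with h
  · have h' : dN k ω = mN S k := by exact_mod_cast h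
    rw [h']; simp
  · have h' : dN k ω ≠ mN S k := by exact_mod_cast h
    rw [map_monomial, map_mul, map_pow, toZMod_p, zero_pow (by omega), mul_zero]; simp

lemma redp_hpolF (F : Fin t → MvPolynomial (Fin n) ℤ_[p]) (hS : (suppF F).Nonempty)
    (k : Fin n → ℕ) (i : Fin t) :
    redp (hpol (suppF F) k (F i)) = redp (facePolyMap F i (toRn k)) := by
  rw [redp_hpol _ hS, facePolyMap, newtonPolyMap_eq]
  exact Finset.subset_biUnion_of_mem (fun i => (F i).support) (Finset.mem_univ i)

lemma redp_hpolg (g : MvPolynomial (Fin n) ℤ_[p]) (hS : g.support.Nonempty) (k : Fin n → ℕ) :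
    redp (hpol g.support k g) = redp (facePoly g (toRn k)) := by
  rw [redp_hpol _ hS _ _ le_rfl, facePoly, newtonPoly_eq]

/-- the cone of a point -/
def cls (F : Fin t → MvPolynomial (Fin n) ℤ_[p]) (g : MvPolynomial (Fin n) ℤ_[p])
    (k : Fin n → ℝ) : Set (Fin n → ℝ) := {k' ∈ orthant n |
    faceOf (newtonPolyMap F) k' = faceOf (newtonPolyMap F) k ∧
    faceOf (newtonPoly g) k' = faceOf (newtonPoly g) k}

lemma DFg_finite (F : Fin t → MvPolynomial (Fin n) ℤ_[p]) (g : MvPolynomial (Fin n) ℤ_[p])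
    (hF : (suppF F).Nonempty) (hg : g.support.Nonempty) : (DFg F g).Finite := by
  classical
  let D : (Fin n → ℝ) → Set (suppF F) × Set g.support × Set (Fin n) := fun k =>
    ({ω | dt k (toR ω.1) = mP (NP (suppF F)) k}, {ω | dt k (toR ω.1) = mP (NP g.support) k},
      {i | k i = 0})
  refine (Set.finite_range (fun d : Set (suppF F) × Set g.support × Set (Fin n) =>
    if h : ∃ k ∈ orthant n, D k = d then cls F g h.choose else ∅)).subset ?_
  rintro δ ⟨k, hk, rfl⟩
  refine ⟨D k, ?_⟩
  have h : ∃ k' ∈ orthant n, D k' = D k := ⟨k, hk, rfl⟩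
  simp only [dif_pos h]
  obtain ⟨h1, h2⟩ := h.choose_spec
  generalize h.choose = k' at h1 h2
  simp only [D, Prod.mk.injEq, Set.ext_iff] at h2
  obtain ⟨hA, hB, hC⟩ := h2
  have e1 : faceOf (newtonPolyMap F) k' = faceOf (newtonPolyMap F) k := by
    rw [newtonPolyMap_eq]
    exact face_eq hF h1 hk (fun ω hω => hA ⟨ω, hω⟩) hC
  have e2 : faceOf (newtonPoly g) k' = faceOf (newtonPoly g) k := by
    rw [newtonPoly_eq]
    exact face_eq hg h1 hk (fun ω hω => hB ⟨ω, hω⟩) hC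
  unfold cls
  rw [e1, e2]

lemma cls_mem (F : Fin t → MvPolynomial (Fin n) ℤ_[p]) (g : MvPolynomial (Fin n) ℤ_[p])
    {k : Fin n → ℝ} (hk : k ∈ orthant n) : cls F g k ∈ DFg F g := ⟨k, hk, rfl⟩

lemma self_mem_cls (F : Fin t → MvPolynomial (Fin n) ℤ_[p]) (g : MvPolynomial (Fin n) ℤ_[p])
    {k : Fin n → ℝ} (hk : k ∈ orthant n) : k ∈ cls F g k := ⟨hk, rfl, rfl⟩

lemma cls_eq_of_mem (F : Fin t → MvPolynomial (Fin n) ℤ_[p]) (g : MvPolynomial (Fin n) ℤ_[p])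
    {δ : Set (Fin n → ℝ)} (hδ : δ ∈ DFg F g) {k : Fin n → ℝ} (hk : k ∈ δ) : cls F g k = δ := by
  obtain ⟨k0, hk0, rfl⟩ := hδ
  obtain ⟨h1, h2, h3⟩ := hk
  unfold cls
  rw [h2, h3]

lemma conePoly_cls (F : Fin t → MvPolynomial (Fin n) ℤ_[p]) (g : MvPolynomial (Fin n) ℤ_[p])
    {k : Fin n → ℝ} (hk : k ∈ orthant n) : conePoly g (cls F g k) = facePoly g k := by
  have h : (cls F g k).Nonempty := ⟨k, self_mem_cls F g hk⟩
  obtain ⟨h1, h2, h3⟩ := h.some_mem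
  rw [conePoly, dif_pos h, facePoly, facePoly, h3]

lemma conePolyMap_cls (F : Fin t → MvPolynomial (Fin n) ℤ_[p]) (g : MvPolynomial (Fin n) ℤ_[p])
    {k : Fin n → ℝ} (hk : k ∈ orthant n) (i : Fin t) :
    conePolyMap F i (cls F g k) = facePolyMap F i k := by
  have h : (cls F g k).Nonempty := ⟨k, self_mem_cls F g hk⟩
  obtain ⟨h1, h2, h3⟩ := h.some_mem
  rw [conePolyMap, dif_pos h, facePolyMap, facePolyMap, h2]

end newton

section assemble1
variable {p : ℕ} [Fact p.Prime] {n t : ℕ}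

lemma eval_redp (a : Fin n → ZMod p) (f : MvPolynomial (Fin n) ℤ_[p]) :
    eval a (redp f) = PadicInt.toZMod (eval (lft a) f) := by
  have : a = fun i => PadicInt.toZMod (lft a i) := funext fun i => (toZMod_lft a i).symm
  conv_lhs => rw [this]
  rw [redp, eval_map]
  exact (eval₂_comp PadicInt.toZMod (lft a) f).symm

lemma eval_pderiv_redp (a : Fin n → ZMod p) (f : MvPolynomial (Fin n) ℤ_[p]) (j : Fin n) :
    eval a (pderiv j (redp f)) = PadicInt.toZMod (eval (lft a) (pderiv j f)) := by
  rw [← eval_redp, redp, redp, pderiv_map]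

lemma isUnit_lft (a : Fin n → ZMod p) (ha : ∀ i, a i ≠ 0) (i : Fin n) : IsUnit (lft a i) := by
  by_contra h
  have h1 : (p : ℤ_[p]) ∣ lft a i := by
    rw [← PadicInt.norm_lt_one_iff_dvd]
    exact PadicInt.mem_nonunits.mp h
  rw [← toZMod_eq_zero_iff, toZMod_lft] at h1
  exact ha i h1

lemma li_of_rank {K : Type*} [Field K] {ι : Type*} [Fintype ι] (M : ι → Fin n → K)
    (h : (Matrix.of M).rank = Fintype.card ι) : LinearIndependent K M := by
  rw [linearIndependent_iff_card_eq_finrank_span, ← h, Matrix.rank_eq_finrank_span_row]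
  rfl

open Classical in
lemma local_k (hnt : t + 1 ≤ n) (F : Fin t → MvPolynomial (Fin n) ℤ_[p])
    (g : MvPolynomial (Fin n) ℤ_[p]) (hF : (suppF F).Nonempty) (hg : g.support.Nonempty)
    (hndg : NonDeg p g) (hndF : StronglyNonDegMap p F) (hpair : StronglyNonDegPair p F g)
    (s : ℂ) (hs : 0 < s.re) (k : Fin n → ℕ) (a : Fin n → ZMod p) (ha : ∀ i, a i ≠ 0) :
    ∫ z, (mapNorm (fun i => hpol (suppF F) k (F i)) (fun l => lft a l + p * z l) : ℂ) ^ s *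
      (‖eval (fun l => lft a l + p * z l) (hpol g.support k g)‖ : ℂ) ∂(padicHaar p n) =
    (if ∀ i, eval a (redp (conePolyMap F i (cls F g (toRn k)))) = 0 then cA p t s else 1) *
    (if eval a (redp (conePoly g (cls F g (toRn k)))) = 0 then 1 / ((p : ℂ) + 1) else 1) := by
  have ed : ∀ f : MvPolynomial (Fin n) ℤ_[p], (p : ℤ_[p]) ∣ eval (lft a) f ↔ eval a (redp f) = 0 := by
    intro f; rw [eval_redp, toZMod_eq_zero_iff]
  have hu := isUnit_lft a ha
  have hcF : ∀ i, redp (hpol (suppF F) k (F i)) = redp (conePolyMap F i (cls F g (toRn k))) := by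
    intro i; rw [conePolyMap_cls F g (toRn_mem k), redp_hpolF F hF]
  have hcg : redp (hpol g.support k g) = redp (conePoly g (cls F g (toRn k))) := by
    rw [conePoly_cls F g (toRn_mem k), redp_hpolg g hg]
  rw [local_int s hs]
  · simp only [ed, hcF, hcg]
  · intro h0
    have h0' : ∀ i, (p : ℤ_[p]) ∣ eval (lft a) (facePolyMap F i (toRn k)) := by
      intro i
      rw [ed, ← redp_hpolF F hF, ← ed]; exact h0 i
    have := hndF _ (toRn_mem k) _ hu h0'
    apply li_of_rank
    rw [min_eq_left (show t ≤ n by omega)] at this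
    rw [Fintype.card_fin]
    refine Eq.trans ?_ this
    simp only [← eval_pderiv_redp, redp_hpolF F hF]
  · intro h0
    have h0' : (p : ℤ_[p]) ∣ eval (lft a) (facePoly g (toRn k)) := by
      rw [ed, ← redp_hpolg g hg, ← ed]; exact h0
    rw [linearIndependent_unique_iff]
    intro hz
    refine hndg _ (toRn_mem k) ⟨lft a, hu, h0', fun j => ?_⟩
    rw [← toZMod_eq_zero_iff, ← eval_pderiv_redp, ← redp_hpolg g hg, eval_pderiv_redp]
    exact congrFun hz j
  · intro h0 h1
    have := hpair _ (cls_mem F g (toRn_mem k)) a ha (fun i => by rw [← hcF, ← ed]; exact h0 i)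
      (by rw [← hcg, ← ed]; exact h1)
    have hli := li_of_rank (fun (i : Fin (t + 1)) (j : Fin n) =>
      Fin.lastCases (motive := fun _ => ZMod p)
        (eval a (pderiv j (redp (conePoly g (cls F g (toRn k))))))
        (fun i' => eval a (pderiv j (redp (conePolyMap F i' (cls F g (toRn k)))))) i)
      (by rw [this, Fintype.card_fin])
    let e : Option (Fin t) → Fin (t + 1) := fun i => i.elim (Fin.last t) Fin.castSucc
    have he : Function.Injective e := by
      rintro (_ | i) (_ | j) hij
      · rfl
      · exact absurd hij.symm (Fin.castSucc_lt_last j).ne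
      · exact absurd hij (Fin.castSucc_lt_last i).ne
      · simpa [e] using hij
    have h2 := hli.comp e he
    convert h2 using 1
    ext i j
    rcases i with _ | i
    · simp [e, ← hcg, eval_pderiv_redp]
    · simp [e, ← hcF, eval_pderiv_redp]

end assemble1

section assemble2
variable {p : ℕ} [Fact p.Prime] {n t : ℕ}

open Classical in
lemma card_units (n : ℕ) [Fintype (Fin n → ZMod p)] :
    (Finset.univ.filter fun a : Fin n → ZMod p => ∀ i, a i ≠ 0).card = (p - 1) ^ n := by
  have : NeZero p := ⟨(Fact.out : p.Prime).ne_zero⟩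
  have h : (Finset.univ.filter fun a : Fin n → ZMod p => ∀ i, a i ≠ 0) =
      Fintype.piFinset (fun _ : Fin n => Finset.univ.erase (0 : ZMod p)) := by
    ext a; simp
  rw [h, Fintype.card_piFinset]
  simp [ZMod.card]

open Classical in
lemma Ldelta_eq [Fintype (Fin n → ZMod p)] (ht : 1 ≤ t) (F : Fin t → MvPolynomial (Fin n) ℤ_[p])
    (g : MvPolynomial (Fin n) ℤ_[p]) (δ : Set (Fin n → ℝ)) (s : ℂ) (hs : 0 < s.re) :
    Ldelta p F g δ s = ((p : ℂ) ^ n)⁻¹ * ∑ a : Fin n → ZMod p, if ∀ i, a i ≠ 0 then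
      (if ∀ i, eval a (redp (conePolyMap F i δ)) = 0 then cA p t s else 1) *
      (if eval a (redp (conePoly g δ)) = 0 then 1 / ((p : ℂ) + 1) else 1) else 0 := by
  have hp : p.Prime := Fact.out
  have hp0 : (p : ℂ) ≠ 0 := by exact_mod_cast hp.ne_zero
  have hp1 : (p : ℂ) + 1 ≠ 0 := by exact_mod_cast (Nat.succ_ne_zero p)
  have hq := q_ne (p := p) (t := t) s hs
  have hpow : (p : ℂ) ^ (s + t) = (p : ℂ) ^ s * (p : ℂ) ^ t := by
    rw [Complex.cpow_add _ _ hp0, Complex.cpow_natCast]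
  have htt : (p : ℂ) ^ t = p * (p : ℂ) ^ (t - 1) := by
    rw [← pow_succ', Nat.sub_add_cancel ht]
  have hN : ∀ P : (Fin n → ZMod p) → Prop, ((Set.ncard {a | P a} : ℕ) : ℂ) =
      ∑ a : Fin n → ZMod p, if P a then (1 : ℂ) else 0 := by
    intro P
    rw [Finset.sum_boole, Set.ncard_eq_toFinset_card', Set.toFinset_ofPred]
  have hU : ((p : ℂ) - 1) ^ n = ∑ a : Fin n → ZMod p, if ∀ i, a i ≠ 0 then (1 : ℂ) else 0 := by
    rw [Finset.sum_boole, card_units]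
    push_cast [Nat.cast_sub hp.one_le]
    rfl
  rw [Ldelta, Ndelta, Pdelta, Qdelta, hN, hN, hN, hU, zpow_neg, zpow_natCast, hpow]
  congr 1
  rw [show ∀ A N P Q : ℂ, A - (p : ℂ) ^ t * N * ((p : ℂ) ^ s - 1) / ((p : ℂ) ^ s * (p : ℂ) ^ t - 1)
      - P * p / ((p : ℂ) + 1) - p * Q * ((p : ℂ) ^ (t - 1) * ((p : ℂ) ^ s * ((p : ℂ) + 1) - 1) - 1)
        / (((p : ℂ) ^ s * (p : ℂ) ^ t - 1) * ((p : ℂ) + 1)) =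
      A - N * ((p : ℂ) ^ t * ((p : ℂ) ^ s - 1) / ((p : ℂ) ^ s * (p : ℂ) ^ t - 1))
      - P * (p / ((p : ℂ) + 1)) - Q * (p * ((p : ℂ) ^ (t - 1) * ((p : ℂ) ^ s * ((p : ℂ) + 1) - 1) - 1)
        / (((p : ℂ) ^ s * (p : ℂ) ^ t - 1) * ((p : ℂ) + 1))) from fun A N P Q => by ring]
  simp only [Finset.sum_mul]
  rw [← Finset.sum_sub_distrib, ← Finset.sum_sub_distrib, ← Finset.sum_sub_distrib]
  refine Finset.sum_congr rfl fun a _ => ?_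
  have hcA : 1 - (p : ℂ) ^ t * ((p : ℂ) ^ s - 1) / ((p : ℂ) ^ s * (p : ℂ) ^ t - 1) = cA p t s := by
    rw [cA, eq_div_iff hq, sub_mul, div_mul_cancel₀ _ hq]; ring
  have hcP : 1 - (p : ℂ) / ((p : ℂ) + 1) = 1 / ((p : ℂ) + 1) := by
    field_simp; ring
  have hcQ : 1 - (p * ((p : ℂ) ^ (t - 1) * ((p : ℂ) ^ s * ((p : ℂ) + 1) - 1) - 1)
        / (((p : ℂ) ^ s * (p : ℂ) ^ t - 1) * ((p : ℂ) + 1))) = cA p t s * (1 / ((p : ℂ) + 1)) := by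
    rw [cA, div_mul_div_comm, mul_one, eq_div_iff (mul_ne_zero hq hp1), sub_mul,
      div_mul_cancel₀ _ (mul_ne_zero hq hp1), htt]
    ring
  by_cases h0 : ∀ i, a i ≠ 0 <;>
  by_cases h1 : ∀ i, eval a (redp (conePolyMap F i δ)) = 0 <;>
  by_cases h2 : eval a (redp (conePoly g δ)) = 0 <;>
  simp only [h0, h1, h2, if_true, if_false, and_true, and_false, true_and, false_and, not_true,
    not_false_iff, ne_eq, one_mul, zero_mul, sub_zero, mul_one, hcA, hcP, hcQ, implies_true]

end assemble2

section assemble3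
variable {p : ℕ} [Fact p.Prime] {n t : ℕ}

/-- the integrand -/
noncomputable def Phi (F : Fin t → MvPolynomial (Fin n) ℤ_[p]) (g : MvPolynomial (Fin n) ℤ_[p])
    (s : ℂ) (x : Fin n → ℤ_[p]) : ℂ := (mapNorm F x : ℂ) ^ s * (‖eval x g‖ : ℂ)

lemma Phi_cont (F : Fin t → MvPolynomial (Fin n) ℤ_[p]) (g : MvPolynomial (Fin n) ℤ_[p])
    (s : ℂ) (hs : 0 < s.re) : Continuous (Phi F g s) := by
  unfold Phi
  refine Continuous.mul ((Complex.continuous_ofReal_cpow_const hs).comp ?_)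
    (Complex.continuous_ofReal.comp ?_)
  · have : mapNorm F = fun x => ‖fun i => eval x (F i)‖ := funext fun x => mapNorm_eq F x
    rw [this]
    exact (continuous_pi fun i => MvPolynomial.continuous_eval (F i)).norm
  · exact (MvPolynomial.continuous_eval g).norm

lemma Phi_int (F : Fin t → MvPolynomial (Fin n) ℤ_[p]) (g : MvPolynomial (Fin n) ℤ_[p])
    (s : ℂ) (hs : 0 < s.re) : Integrable (Phi F g s) (padicHaar p n) :=
  (Phi_cont F g s hs).integrable_of_hasCompactSupport (HasCompactSupport.of_compactSpace _)

/-- unit vectors -/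
def uset (p : ℕ) [Fact p.Prime] (n : ℕ) : Set (Fin n → ℤ_[p]) :=
  {x | ∀ i, PadicInt.toZMod (x i) ≠ 0}

lemma uset_meas : MeasurableSet (uset p n) := by
  have : uset p n = ⋂ i, ((fun x : Fin n → ℤ_[p] => x i) ⁻¹' {x : ℤ_[p] | PadicInt.toZMod x = 0})ᶜ := by
    ext x; simp [uset]
  rw [this]
  exact MeasurableSet.iInter fun i =>
      ((continuous_toZMod_pre 0).preimage (continuous_apply i)).measurableSet.compl

/-- cells -/
def cell (k : Fin n → ℕ) : Set (Fin n → ℤ_[p]) := scal k '' uset p n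

lemma cell_meas (k : Fin n → ℕ) : MeasurableSet (cell (p := p) k) :=
  (scal_emb k).measurableSet_image.mpr uset_meas

lemma cell_int (k : Fin n → ℕ) (φ : (Fin n → ℤ_[p]) → ℂ) :
    ∫ x in cell k, φ x ∂(padicHaar p n) =
      ((p : ℂ) ^ (∑ i, k i))⁻¹ * ∫ z, (uset p n).indicator (fun z => φ (scal k z)) z ∂(padicHaar p n) := by
  have h1 : ∫ x in cell k, φ x ∂(padicHaar p n) =
      ∫ x in Set.range (scal k), (cell k).indicator φ x ∂(padicHaar p n) := by
    rw [setIntegral_indicator (cell_meas k)]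
    congr 2
    exact (Set.inter_eq_right.mpr (Set.image_subset_range _ _)).symm
  rw [h1, setIntegral_range_scal]
  congr 2
  ext z
  by_cases hz : z ∈ uset p n
  · rw [Set.indicator_of_mem hz, Set.indicator_of_mem (show scal k z ∈ cell k from ⟨z, hz, rfl⟩)]
  · rw [Set.indicator_of_notMem hz, Set.indicator_of_notMem]
    rintro ⟨w, hw, he⟩
    exact hz (scal_inj k he ▸ hw)

lemma Phi_scal (F : Fin t → MvPolynomial (Fin n) ℤ_[p]) (g : MvPolynomial (Fin n) ℤ_[p])
    (s : ℂ) (k : Fin n → ℕ) (u : Fin n → ℤ_[p]) :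
    Phi F g s (scal k u) = ((p : ℂ) ^ (-(mN (suppF F) k : ℂ) * s) * ((p : ℂ) ^ mN g.support k)⁻¹) *
      Phi (fun i => hpol (suppF F) k (F i)) (hpol g.support k g) s u := by
  have e1 : ∀ i, eval (scal k u) (F i) =
      (p : ℤ_[p]) ^ mN (suppF F) k * eval u (hpol (suppF F) k (F i)) := fun i =>
    eval_hpol _ k _ (Finset.subset_biUnion_of_mem (fun i => (F i).support) (Finset.mem_univ i)) u
  unfold Phi
  simp only [mapNorm_eq, e1, eval_hpol g.support k g le_rfl u]
  rw [norm_p_mul, cpow_inv_mul _ _ _ (norm_nonneg _), norm_mul, norm_pow, PadicInt.norm_p]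
  push_cast
  rw [inv_pow]
  ring

lemma Sterm_eq (F : Fin t → MvPolynomial (Fin n) ℤ_[p])
    (g : MvPolynomial (Fin n) ℤ_[p]) (hF : (suppF F).Nonempty) (hg : g.support.Nonempty)
    (s : ℂ) (k : Fin n → ℕ) : Sterm p F g s k = ((p : ℂ) ^ (∑ i, k i))⁻¹ *
      ((p : ℂ) ^ (-(mN (suppF F) k : ℂ) * s) * ((p : ℂ) ^ mN g.support k)⁻¹) := by
  have hp0 : (p : ℂ) ≠ 0 := by exact_mod_cast (Fact.out : p.Prime).ne_zero
  have e : (sigmaFn k : ℂ) = ((∑ i, k i : ℕ) : ℂ) := by simp [sigmaFn]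
  rw [Sterm, newtonPolyMap_eq, newtonPoly_eq, mP_eq_mN hF, mP_eq_mN hg, Complex.cpow_sub _ _ hp0,
    Complex.cpow_sub _ _ hp0, e, Complex.cpow_natCast, Complex.ofReal_natCast, Complex.ofReal_natCast,
    Complex.cpow_natCast]
  ring

lemma cell_Phi (hnt : t + 1 ≤ n) (ht : 1 ≤ t) (F : Fin t → MvPolynomial (Fin n) ℤ_[p])
    (g : MvPolynomial (Fin n) ℤ_[p]) (hF : (suppF F).Nonempty) (hg : g.support.Nonempty)
    (hndg : NonDeg p g) (hndF : StronglyNonDegMap p F) (hpair : StronglyNonDegPair p F g)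
    (s : ℂ) (hs : 0 < s.re) (k : Fin n → ℕ) :
    ∫ x in cell k, Phi F g s x ∂(padicHaar p n) =
      Ldelta p F g (cls F g (toRn k)) s * Sterm p F g s k := by
  classical
  have : NeZero p := ⟨(Fact.out : p.Prime).ne_zero⟩
  rw [cell_int, Sterm_eq F g hF hg, Ldelta_eq ht F g _ s hs]
  simp only [Phi_scal]
  rw [integral_residues]
  · have : ∀ a : Fin n → ZMod p, ∫ z, (uset p n).indicator (fun z =>
        ((p : ℂ) ^ (-(mN (suppF F) k : ℂ) * s) * ((p : ℂ) ^ mN g.support k)⁻¹) *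
        Phi (fun i => hpol (suppF F) k (F i)) (hpol g.support k g) s z)
          (fun i => lft a i + p * z i) ∂(padicHaar p n) =
        ((p : ℂ) ^ (-(mN (suppF F) k : ℂ) * s) * ((p : ℂ) ^ mN g.support k)⁻¹) *
        if ∀ i, a i ≠ 0 then
      (if ∀ i, eval a (redp (conePolyMap F i (cls F g (toRn k)))) = 0 then cA p t s else 1) *
      (if eval a (redp (conePoly g (cls F g (toRn k)))) = 0 then 1 / ((p : ℂ) + 1) else 1) else 0 := by
      intro a
      have hm : ∀ z : Fin n → ℤ_[p], (fun i => lft a i + p * z i) ∈ uset p n ↔ ∀ i, a i ≠ 0 := by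
        intro z
        refine forall_congr' fun i => ?_
        rw [map_add, map_mul, toZMod_p, zero_mul, add_zero, toZMod_lft]
      by_cases ha : ∀ i, a i ≠ 0
      · rw [if_pos ha, ← local_k hnt F g hF hg hndg hndF hpair s hs k a ha, ← integral_const_mul]
        refine integral_congr_ae (Filter.Eventually.of_forall fun z => ?_)
        simp only
        rw [Set.indicator_of_mem ((hm z).mpr ha)]
        rfl
      · rw [if_neg ha, mul_zero]
        refine Eq.trans (integral_congr_ae (Filter.Eventually.of_forall fun z => ?_)) (integral_zero _ _)
        simp only
        rw [Set.indicator_of_notMem (fun h => ha ((hm z).mp h))]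
    simp only [this]
    rw [← Finset.mul_sum]
    ring
  · exact ((Phi_int _ _ s hs).const_mul _).indicator uset_meas

end assemble3

section assemble4
variable {p : ℕ} [Fact p.Prime] {n t : ℕ}

lemma norm_of_toZMod_ne {x : ℤ_[p]} (h : PadicInt.toZMod x ≠ 0) : ‖x‖ = 1 := by
  refine le_antisymm (PadicInt.norm_le_one _) ?_
  by_contra hlt
  rw [not_le, PadicInt.norm_lt_one_iff_dvd, ← toZMod_eq_zero_iff] at hlt
  exact h hlt

lemma cell_disj : Pairwise (Function.onFun Disjoint (cell (p := p) (n := n))) := by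
  intro k k' hk
  rw [Function.onFun, Set.disjoint_left]
  rintro x ⟨z, hz, rfl⟩ ⟨z', hz', he⟩
  apply hk
  ext i
  have h := congrArg norm (congrFun he i)
  rw [scal_apply, scal_apply, norm_mul, norm_mul, norm_of_toZMod_ne (hz i), norm_of_toZMod_ne (hz' i),
    norm_pow, norm_pow, PadicInt.norm_p, mul_one, mul_one, inv_pow, inv_pow, inv_inj] at h
  exact (pow_right_injective₀ (by linarith [p_gt_one (p := p)]) (p_gt_one (p := p)).ne' h).symm

lemma hyper_null (i : Fin n) : padicHaar p n {x | x i = 0} = 0 := by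
  have hle : ∀ m : ℕ, padicHaar p n {x | x i = 0} ≤ ((p : ENNReal)⁻¹) ^ m := by
    intro m
    have : {x : Fin n → ℤ_[p] | x i = 0} ⊆ Set.range (scal (p := p) (Pi.single i m)) := by
      intro x hx
      rw [mem_range_scal]
      intro j
      by_cases hj : j = i
      · subst hj
        rw [show x j = 0 from hx]; exact dvd_zero _
      · simp [hj]
    refine (measure_mono this).trans ?_
    rw [measure_range_scal, ENNReal.inv_pow]
    simp
  have hlt : (p : ENNReal)⁻¹ < 1 := by
    rw [ENNReal.inv_lt_one]
    exact_mod_cast (Fact.out : p.Prime).one_lt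
  exact le_antisymm (ge_of_tendsto' (ENNReal.tendsto_pow_atTop_nhds_zero_of_lt_one hlt) hle) bot_le

lemma cells_ae : (⋃ k : Fin n → ℕ, cell (p := p) k) =ᵐ[padicHaar p n] Set.univ := by
  rw [ae_eq_univ]
  refine measure_mono_null (t := ⋃ i, {x | x i = 0}) ?_ (measure_iUnion_null fun i => hyper_null i)
  intro x hx
  by_contra h
  simp only [Set.mem_iUnion, not_exists] at h
  apply hx
  rw [Set.mem_iUnion]
  have h' : ∀ i, x i ≠ 0 := fun i hi => h i hi
  refine ⟨fun i => (x i).valuation, fun i => (PadicInt.unitCoeff (h' i) : ℤ_[p]), ?_, ?_⟩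
  · intro i h0
    rw [toZMod_eq_zero_iff, ← PadicInt.norm_lt_one_iff_dvd] at h0
    simp at h0
  · ext1 i
    rw [scal_apply, mul_comm]
    exact (PadicInt.unitCoeff_spec (h' i)).symm

lemma hasSum_cells (φ : (Fin n → ℤ_[p]) → ℂ) (hφ : Integrable φ (padicHaar p n)) :
    HasSum (fun k : Fin n → ℕ => ∫ x in cell k, φ x ∂(padicHaar p n)) (∫ x, φ x ∂(padicHaar p n)) := by
  have := hasSum_integral_iUnion (fun k => cell_meas (p := p) k) (cell_disj (p := p) (n := n))
    (hφ.integrableOn (s := ⋃ k, cell k))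
  rwa [setIntegral_congr_set cells_ae, setIntegral_univ] at this

lemma summable_psigma : Summable (fun k : Fin n → ℕ => ((p : ℝ) ^ (∑ i, k i))⁻¹) := by
  have h := (hasSum_cells (p := p) (n := n) (fun _ => 1) (integrable_const _)).summable
  simp only [cell_int] at h
  have hopen : IsOpen (uset p n) := by
    have : uset p n = ⋂ i, (fun x : Fin n → ℤ_[p] => x i) ⁻¹'
        (⋃ a ∈ {a : ZMod p | a ≠ 0}, {x : ℤ_[p] | PadicInt.toZMod x = a}) := by
      ext x; simp [uset]
    rw [this]
    exact isOpen_iInter_of_finite fun i =>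
      (isOpen_biUnion fun a _ => continuous_toZMod_pre a).preimage (continuous_apply i)
  have hpos : (padicHaar p n).real (uset p n) ≠ 0 := by
    rw [Measure.real, ENNReal.toReal_ne_zero]
    refine ⟨(hopen.measure_pos _ ⟨fun _ => 1, fun i => by simp⟩).ne', measure_ne_top _ _⟩
  have hc : ∫ z, (uset p n).indicator (fun _ => (1 : ℂ)) z ∂(padicHaar p n) ≠ 0 := by
    rw [integral_indicator uset_meas]
    simpa using hpos
  have h2 := (summable_mul_right_iff hc).mp h
  have h3 := h2.norm
  simpa using h3

lemma Sterm_summable (F : Fin t → MvPolynomial (Fin n) ℤ_[p])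
    (g : MvPolynomial (Fin n) ℤ_[p]) (hF : (suppF F).Nonempty) (hg : g.support.Nonempty)
    (s : ℂ) (hs : 0 < s.re) : Summable (fun k : Fin n → ℕ => ‖Sterm p F g s k‖) := by
  refine Summable.of_nonneg_of_le (fun _ => norm_nonneg _) (fun k => ?_) (summable_psigma (p := p) (n := n))
  have hp1 := p_gt_one (p := p)
  rw [Sterm_eq F g hF hg, norm_mul, norm_mul, norm_inv, norm_pow, norm_inv, norm_pow, Complex.norm_natCast]
  refine mul_le_of_le_one_right (by positivity) ?_
  refine mul_le_one₀ ?_ (by positivity) (inv_le_one_of_one_le₀ (one_le_pow₀ hp1.le))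
  rw [Complex.norm_natCast_cpow_of_pos (Fact.out : p.Prime).pos]
  apply Real.rpow_le_one_of_one_le_of_nonpos hp1.le
  have : (-(mN (suppF F) k : ℂ) * s).re = -((mN (suppF F) k : ℝ) * s.re) := by simp
  rw [this]
  have : 0 ≤ (mN (suppF F) k : ℝ) * s.re := by positivity
  linarith

end assemble4


/-- **Theorem (Igusa's zeta function of a polynomial mapping and a polynomial
measure).** For a nonconstant polynomial mapping `F = (f_1,…,f_t)` with `f_i(0) = 0`,
`n ≥ t + 1`, and a nonconstant `g` with `g(0) = 0` non-degenerated w.r.t. `Γ(g)`,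
if `F` is strongly non-degenerated w.r.t. `Γ(F)` and `(F,g)` is strongly
non-degenerated w.r.t. `D_{F,g}`, then for `Re(s) > 0` the series `S_δ(s)` converge
absolutely and `Z_{F,g}(s) = ∫_{ℤ_p^n} ‖F(x)‖^s |g(x)| dμ = Σ_{δ ∈ D_{F,g}} L_δ(s) S_δ(s)`
(the partition `D_{F,g}` being finite). -/
theorem igusa_zeta_map_poly_measure (p : ℕ) [Fact p.Prime] (n t : ℕ) (hnt : t + 1 ≤ n)
    (F : Fin t → MvPolynomial (Fin n) ℤ_[p])
    (hFnc : ∃ i, F i ≠ 0) (hF0 : ∀ i, (F i).coeff 0 = 0)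
    (g : MvPolynomial (Fin n) ℤ_[p]) (hgnc : g ≠ 0) (hg0 : g.coeff 0 = 0)
    (hndg : NonDeg p g) (hndF : StronglyNonDegMap p F)
    (hpair : StronglyNonDegPair p F g)
    (s : ℂ) (hs : 0 < s.re) :
    (DFg F g).Finite ∧
    (∀ δ ∈ DFg F g,
      Summable (fun k : {k : Fin n → ℕ // toRn k ∈ δ} => ‖Sterm p F g s k‖)) ∧
    ∫ x, (mapNorm F x : ℂ) ^ s * (‖eval x g‖ : ℂ) ∂(padicHaar p n)
      = ∑' δ : DFg F g, Ldelta p F g δ s * Sdelta p F g δ s := by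
  have hF : (suppF F).Nonempty := by
    obtain ⟨i, hi⟩ := hFnc
    obtain ⟨ω, hω⟩ := Finset.nonempty_iff_ne_empty.mpr fun h => hi (MvPolynomial.support_eq_empty.mp h)
    exact ⟨ω, Finset.mem_biUnion.mpr ⟨i, Finset.mem_univ i, hω⟩⟩
  have hg : g.support.Nonempty := Finset.nonempty_iff_ne_empty.mpr fun h => hgnc (MvPolynomial.support_eq_empty.mp h)
  have ht : 1 ≤ t := by
    obtain ⟨i, hi⟩ := hFnc
    exact Nat.one_le_iff_ne_zero.mpr fun h => by subst h; exact i.elim0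
  have hsum := Sterm_summable F g hF hg s hs
  refine ⟨DFg_finite F g hF hg, fun δ _ => hsum.comp_injective Subtype.val_injective, ?_⟩
  have hmain := hasSum_cells (Phi F g s) (Phi_int F g s hs)
  simp only [cell_Phi hnt ht F g hF hg hndg hndF hpair s hs] at hmain
  let e : (Σ δ : DFg F g, {k : Fin n → ℕ // toRn k ∈ δ.1}) ≃ (Fin n → ℕ) :=
    { toFun := fun x => x.2.1
      invFun := fun k => ⟨⟨cls F g (toRn k), cls_mem F g (toRn_mem k)⟩,
        ⟨k, self_mem_cls F g (toRn_mem k)⟩⟩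
      left_inv := by
        rintro ⟨⟨δ, hδ⟩, ⟨k, hk⟩⟩
        have := cls_eq_of_mem F g hδ hk
        subst this
        rfl
      right_inv := fun k => rfl }
  have h2 := (e.hasSum_iff).mpr hmain
  have h3 : ∀ δ : DFg F g, HasSum (fun k : {k : Fin n → ℕ // toRn k ∈ δ.1} =>
      ((fun k => Ldelta p F g (cls F g (toRn k)) s * Sterm p F g s k) ∘ e) ⟨δ, k⟩)
      (Ldelta p F g δ s * Sdelta p F g δ s) := by
    intro δ
    have h4 : Summable (fun k : {k : Fin n → ℕ // toRn k ∈ δ.1} => Sterm p F g s k) :=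
      hsum.of_norm.comp_injective Subtype.val_injective
    have h5 := h4.hasSum.mul_left (Ldelta p F g δ s)
    refine Eq.mp (congrArg (fun q => HasSum q _) (funext fun k => ?_)) h5
    symm
    change Ldelta p F g (cls F g (toRn k.1)) s * Sterm p F g s k.1 = _
    rw [cls_eq_of_mem F g δ.2 k.2]
  exact (h2.sigma h3).tsum_eq.symm
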